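/- (Convergence of the two-node Gibbs sampler under convexity.) Let d ≥ 1, η > 0, let f, g : ℝ^d → ℝ be convex with exp(−f) and exp(−g) integrable, and let π^{XY} be the probability measure on ℝ^d × ℝ^d with density proportional to exp(−f(x) − g(y) − ‖x−y‖²/(2η)), with marginals π^X, π^Y and conditionals π^{Y|X=x} ∝ exp(−g(y) − ‖x−y‖²/(2η)), π^{X|Y=y} ∝ exp(−f(x) − ‖x−y‖²/(2η)). Let μ_0^X be a probability measure on ℝ^d with finite second moment and D_KL(μ_0^X ‖ π^X) < ∞, and define recursively μ_k^Y(y) = ∫ π^{Y|X=x}(y) dμ_k^X(x), μ_{k+1}^X(x) = ∫ π^{X|Y=y}(x) dμ_k^Y(y), and let μ_k^{XY} be the measure with density (x,y) ↦ μ_k^X(x) π^{Y|X=x}(y). Then for every k ≥ 1, D_KL(μ_k^{XY} ‖ π^{XY}) ≤ W_2²(μ_0^X, π^X) / (k η). -/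

import Mathlib

open MeasureTheory Real
open scoped ENNReal Classical

noncomputable section

/-- Kullback–Leibler divergence `D_KL(μ ‖ ν) = ∫ log(dμ/dν) dμ` (valued in `[0,∞]`,
with the convention that it is `∞` when `μ` is not absolutely continuous w.r.t. `ν`;
for `μ ≪ ν` it is computed via the nonnegative integrand `f log f − f + 1`,
`f = dμ/dν`, integrated against `ν`). -/
def klDiv {X : Type*} [MeasurableSpace X] (μ ν : Measure X) : ℝ≥0∞ :=
  if μ ≪ ν then
    ∫⁻ x, ENNReal.ofReal ((μ.rnDeriv ν x).toReal * Real.log ((μ.rnDeriv ν x).toReal)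
      - (μ.rnDeriv ν x).toReal + 1) ∂ν
  else ⊤

/-- Squared 2-Wasserstein distance: infimum over couplings `γ` of `μ` and `ν` of
`∫ ‖x − y‖² dγ(x,y)`. -/
def W2sq {E : Type*} [NormedAddCommGroup E] [MeasurableSpace E]
    (μ ν : Measure E) : ℝ :=
  sInf { r : ℝ | ∃ γ : Measure (E × E),
    γ.map Prod.fst = μ ∧ γ.map Prod.snd = ν ∧ r = ∫ w, ‖w.1 - w.2‖ ^ 2 ∂γ }

variable (d : ℕ) (η : ℝ)

/-- Unnormalized density `exp(−f(x) − g(y) − ‖x−y‖²/(2η))` of the two-node target. -/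
def jointDens (f g : EuclideanSpace ℝ (Fin d) → ℝ)
    (p : EuclideanSpace ℝ (Fin d) × EuclideanSpace ℝ (Fin d)) : ℝ :=
  Real.exp (-f p.1 - g p.2 - ‖p.1 - p.2‖ ^ 2 / (2 * η))

/-- The two-node target measure `π^{XY} ∝ exp(−f(x) − g(y) − ‖x−y‖²/(2η))`. -/
def targetXY (f g : EuclideanSpace ℝ (Fin d) → ℝ) :
    Measure (EuclideanSpace ℝ (Fin d) × EuclideanSpace ℝ (Fin d)) :=
  volume.withDensity fun p =>
    ENNReal.ofReal (jointDens d η f g p / ∫ q, jointDens d η f g q)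

/-- The `X`-marginal `π^X` of the two-node target. -/
def targetX (f g : EuclideanSpace ℝ (Fin d) → ℝ) :
    Measure (EuclideanSpace ℝ (Fin d)) :=
  (targetXY d η f g).map Prod.fst

/-- The conditional density `π^{Y|X=x}(y) ∝ exp(−g(y) − ‖x−y‖²/(2η))`. -/
def condYgivenX (g : EuclideanSpace ℝ (Fin d) → ℝ)
    (x y : EuclideanSpace ℝ (Fin d)) : ℝ :=
  Real.exp (-g y - ‖x - y‖ ^ 2 / (2 * η)) /
    ∫ y', Real.exp (-g y' - ‖x - y'‖ ^ 2 / (2 * η))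

/-- The conditional density `π^{X|Y=y}(x) ∝ exp(−f(x) − ‖x−y‖²/(2η))`. -/
def condXgivenY (f : EuclideanSpace ℝ (Fin d) → ℝ)
    (y x : EuclideanSpace ℝ (Fin d)) : ℝ :=
  Real.exp (-f x - ‖x - y‖ ^ 2 / (2 * η)) /
    ∫ x', Real.exp (-f x' - ‖x' - y‖ ^ 2 / (2 * η))

/-- The one-dimensional Brunn–Minkowski inequality. -/
lemma volume_add_volume_le {A B C : Set ℝ} (hA : MeasurableSet A) (hB : MeasurableSet B)
    (nA : A.Nonempty) (nB : B.Nonempty) (h : ∀ a ∈ A, ∀ b ∈ B, a + b ∈ C) :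
    volume A + volume B ≤ volume C := by
  have key : ∀ K L : Set ℝ, IsCompact K → IsCompact L → K ⊆ A → L ⊆ B → K.Nonempty →
      L.Nonempty → volume K + volume L ≤ volume C := by
    intro K L hK hL hKA hLB nK nL
    set k := sSup K
    set l := sInf L
    have hk : k ∈ K := hK.sSup_mem nK
    have hl : l ∈ L := hL.sInf_mem nL
    have h1 : volume ((fun x => x + l) '' K) = volume K := by
      simp
    have h2 : volume ((fun x => k + x) '' L) = volume L := by
      simp
    have m2 : MeasurableSet ((fun x => k + x) '' L) :=
      (hL.image (by fun_prop)).measurableSet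
    have hd : AEDisjoint volume ((fun x => x + l) '' K) ((fun x => k + x) '' L) := by
      refine measure_mono_null (t := {k + l}) ?_ (by simp)
      rintro _ ⟨⟨x, hx, rfl⟩, ⟨y, hy, hxy⟩⟩
      have hx' : x ≤ k := le_csSup hK.bddAbove hx
      have hy' : l ≤ y := csInf_le hL.bddBelow hy
      simp only [Set.mem_singleton_iff] at *
      linarith
    rw [← h1, ← h2, ← measure_union₀ m2.nullMeasurableSet hd]
    apply measure_mono
    rintro _ (⟨x, hx, rfl⟩ | ⟨x, hx, rfl⟩)
    · exact h x (hKA hx) l (hLB hl)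
    · exact h k (hKA hk) x (hLB hx)
  obtain ⟨a, ha⟩ := nA
  obtain ⟨b, hb⟩ := nB
  have key' : ∀ K L : Set ℝ, IsCompact K → IsCompact L → K ⊆ A → L ⊆ B →
      volume K + volume L ≤ volume C := by
    intro K L hK hL hKA hLB
    calc volume K + volume L ≤ volume (insert a K) + volume (insert b L) := by
          gcongr <;> exact Set.subset_insert _ _
      _ ≤ volume C := key _ _ (hK.insert a) (hL.insert b) (Set.insert_subset ha hKA)
          (Set.insert_subset hb hLB) (Set.insert_nonempty _ _) (Set.insert_nonempty _ _)
  rw [hA.measure_eq_iSup_isCompact, hB.measure_eq_iSup_isCompact]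
  simp only [iSup_and']
  exact ENNReal.biSup_add_biSup_le' ⟨∅, by simp⟩ ⟨∅, by simp⟩
    fun K hK L hL => key' K L hK.2 hL.2 hK.1 hL.1

/-- The Prékopa–Leindler property of a measure. -/
def PrekopaLeindler {E : Type*} [MeasurableSpace E] [AddCommGroup E] [Module ℝ E]
    (m : Measure E) : Prop :=
  ∀ (t : ℝ), 0 < t → t < 1 → ∀ u v w : E → ℝ≥0∞, Measurable u → Measurable v → Measurable w →
    (∀ p q, u p ^ (1 - t) * v q ^ t ≤ w ((1 - t) • p + t • q)) →
    (∫⁻ x, u x ∂m) ^ (1 - t) * (∫⁻ x, v x ∂m) ^ t ≤ ∫⁻ x, w x ∂m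

lemma PrekopaLeindler.prod {E F : Type*} [MeasurableSpace E] [AddCommGroup E] [Module ℝ E]
    [MeasurableSpace F] [AddCommGroup F] [Module ℝ F] {m : Measure E} {n : Measure F}
    [SFinite m] [SFinite n]
    (hm : PrekopaLeindler m) (hn : PrekopaLeindler n) : PrekopaLeindler (m.prod n) := by
  intro t h0 h1 u v w hu hv hw h
  rw [lintegral_prod _ hu.aemeasurable, lintegral_prod _ hv.aemeasurable,
    lintegral_prod _ hw.aemeasurable]
  refine hm t h0 h1 _ _ _ hu.lintegral_prod_right' hv.lintegral_prod_right'
    hw.lintegral_prod_right' fun p q => ?_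
  refine hn t h0 h1 _ _ _ (by fun_prop) (by fun_prop) (by fun_prop) fun p' q' => ?_
  exact h (p, p') (q, q')

lemma PrekopaLeindler.of_measurePreserving {E F : Type*} [MeasurableSpace E] [AddCommGroup E]
    [Module ℝ E] [MeasurableSpace F] [AddCommGroup F] [Module ℝ F] {m : Measure E} {n : Measure F}
    (hm : PrekopaLeindler m) {e : E → F} (he : MeasurePreserving e m n)
    (hlin : ∀ (a b : ℝ) (p q : E), e (a • p + b • q) = a • e p + b • e q) :
    PrekopaLeindler n := by
  intro t h0 h1 u v w hu hv hw h
  rw [← he.lintegral_comp hu, ← he.lintegral_comp hv, ← he.lintegral_comp hw]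
  refine hm t h0 h1 _ _ _ (hu.comp he.measurable) (hv.comp he.measurable)
    (hw.comp he.measurable) fun p q => ?_
  rw [hlin]
  exact h _ _

open scoped Pointwise in
lemma prekopaLeindler_real_of_le_one {t : ℝ} (h0 : 0 < t) (h1 : t < 1) {u v w : ℝ → ℝ}
    (hu : Measurable u) (hv : Measurable v) (hw : Measurable w)
    (u0 : ∀ x, 0 ≤ u x) (u1 : ∀ x, u x ≤ 1) (v0 : ∀ x, 0 ≤ v x) (v1 : ∀ x, v x ≤ 1)
    (w0 : ∀ x, 0 ≤ w x) (us : ∀ s < 1, ∃ x, s < u x) (vs : ∀ s < 1, ∃ x, s < v x)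
    (h : ∀ p q, u p ^ (1 - t) * v q ^ t ≤ w ((1 - t) * p + t * q)) :
    ENNReal.ofReal (1 - t) * (∫⁻ x, ENNReal.ofReal (u x)) +
      ENNReal.ofReal t * (∫⁻ x, ENNReal.ofReal (v x)) ≤ ∫⁻ x, ENNReal.ofReal (w x) := by
  rw [lintegral_eq_lintegral_meas_lt volume (.of_forall u0) hu.aemeasurable,
    lintegral_eq_lintegral_meas_lt volume (.of_forall v0) hv.aemeasurable,
    lintegral_eq_lintegral_meas_lt volume (.of_forall w0) hw.aemeasurable,
    ← lintegral_const_mul' _ _ (by simp), ← lintegral_const_mul' _ _ (by simp),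
    ← lintegral_add_left']
  · refine setLIntegral_mono' measurableSet_Ioi fun s hs => ?_
    have hs : 0 < s := hs
    by_cases hs1 : s < 1
    · have e1 : ENNReal.ofReal (1 - t) * volume {a | s < u a} =
          volume ((1 - t) • {a | s < u a}) := by
        rw [Measure.addHaar_smul]; simp [abs_of_pos (sub_pos.2 h1)]
      have e2 : ENNReal.ofReal t * volume {a | s < v a} = volume (t • {a | s < v a}) := by
        rw [Measure.addHaar_smul]; simp [abs_of_pos h0]
      rw [e1, e2]
      refine volume_add_volume_le ?_ ?_ ?_ ?_ ?_
      · exact (measurableSet_lt measurable_const hu).const_smul_of_ne_zero (by linarith)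
      · exact (measurableSet_lt measurable_const hv).const_smul_of_ne_zero h0.ne'
      · exact Set.Nonempty.smul_set (us s hs1)
      · exact Set.Nonempty.smul_set (vs s hs1)
      · rintro _ ⟨p, hp, rfl⟩ _ ⟨q, hq, rfl⟩
        refine lt_of_lt_of_le ?_ (h p q)
        have hp : s < u p := hp
        have hq : s < v q := hq
        calc s = s ^ (1 - t) * s ^ t := by rw [← Real.rpow_add hs]; simp
          _ < u p ^ (1 - t) * v q ^ t := by
            have := Real.rpow_lt_rpow hs.le hp (sub_pos.2 h1)
            have := Real.rpow_lt_rpow hs.le hq h0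
            have := Real.rpow_pos_of_pos hs (1 - t)
            have := Real.rpow_pos_of_pos hs t
            gcongr
    · have e1 : {a | s < u a} = ∅ := by
        ext a; simp only [Set.mem_ofPred_eq, Set.mem_empty_iff_false, iff_false, not_lt]
        linarith [u1 a]
      have e2 : {a | s < v a} = ∅ := by
        ext a; simp only [Set.mem_ofPred_eq, Set.mem_empty_iff_false, iff_false, not_lt]
        linarith [v1 a]
      simp [e1, e2]
  · refine (Antitone.measurable fun s r hsr => ?_).aemeasurable
    gcongr

lemma ENNReal.rpow_mul_rpow_le_add {t : ℝ} (h0 : 0 < t) (h1 : t < 1) (x y : ℝ≥0∞) :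
    x ^ (1 - t) * y ^ t ≤ ENNReal.ofReal (1 - t) * x + ENNReal.ofReal t * y := by
  have h1' : 0 < 1 - t := sub_pos.2 h1
  rcases eq_or_ne x ⊤ with rfl | hx
  · rw [ENNReal.mul_top (by simpa using h1)]; simp
  rcases eq_or_ne y ⊤ with rfl | hy
  · rw [ENNReal.mul_top (by simpa using h0)]; simp
  lift x to NNReal using hx
  lift y to NNReal using hy
  have := NNReal.geom_mean_le_arith_mean2_weighted (1 - t).toNNReal t.toNNReal x y
    (by rw [← Real.toNNReal_add h1'.le h0.le]; simp)
  rw [Real.coe_toNNReal _ h0.le, Real.coe_toNNReal _ h1'.le] at this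
  rw [← ENNReal.coe_rpow_of_nonneg _ h0.le, ← ENNReal.coe_rpow_of_nonneg _ h1'.le]
  rw [ENNReal.ofReal, ENNReal.ofReal]
  exact_mod_cast this

lemma prekopaLeindler_real_of_bounded {t : ℝ} (h0 : 0 < t) (h1 : t < 1) {u v w : ℝ → ℝ≥0∞}
    (hu : Measurable u) (hv : Measurable v) (hw : Measurable w)
    (ub : ⨆ x, u x ≠ ⊤) (vb : ⨆ x, v x ≠ ⊤)
    (h : ∀ p q, u p ^ (1 - t) * v q ^ t ≤ w ((1 - t) * p + t * q)) :
    (∫⁻ x, u x) ^ (1 - t) * (∫⁻ x, v x) ^ t ≤ ∫⁻ x, w x := by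
  have h1' : 0 < 1 - t := sub_pos.2 h1
  set a := ⨆ x, u x with ha
  set b := ⨆ x, v x with hb
  rcases eq_or_ne a 0 with ha0 | ha0
  · have : ∀ x, u x = 0 := by simpa [ha] using ha0
    simp [this, h1']
  rcases eq_or_ne b 0 with hb0 | hb0
  · have : ∀ x, v x = 0 := by simpa [hb] using hb0
    simp [this, h0]
  set c := a ^ (1 - t) * b ^ t with hc
  have hc0 : c ≠ 0 := by simp [hc, ha0, hb0, ub, vb]
  have hct : c ≠ ⊤ := by
    apply ENNReal.mul_ne_top <;> apply ENNReal.rpow_ne_top_of_nonneg <;> first | linarith | assumption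
  have ule : ∀ x, u x / a ≤ 1 := fun x => ENNReal.div_le_of_le_mul (by simpa using le_iSup u x)
  have vle : ∀ x, v x / b ≤ 1 := fun x => ENNReal.div_le_of_le_mul (by simpa using le_iSup v x)
  have unt : ∀ x, u x / a ≠ ⊤ := fun x => ne_top_of_le_ne_top (by simp) (ule x)
  have vnt : ∀ x, v x / b ≠ ⊤ := fun x => ne_top_of_le_ne_top (by simp) (vle x)
  have wnt : ∀ x, min 1 (w x / c) ≠ ⊤ := fun x => ne_top_of_le_ne_top (by simp) (min_le_left _ _)
  have hsup : ∀ (f : ℝ → ℝ≥0∞) (A : ℝ≥0∞), A = ⨆ x, f x → A ≠ 0 → A ≠ ⊤ →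
      (∀ x, f x / A ≠ ⊤) → ∀ s < 1, ∃ x, s < (f x / A).toReal := by
    intro f A hA hA0 hAt hnt s hs
    rcases lt_or_ge s 0 with hs0 | hs0
    · exact ⟨0, hs0.trans_le ENNReal.toReal_nonneg⟩
    have : ENNReal.ofReal s * A < ⨆ x, f x := by
      rw [← hA]
      calc _ < 1 * A := by
            rw [ENNReal.mul_lt_mul_iff_left hA0 hAt]; simpa using hs
        _ = A := one_mul A
    obtain ⟨x, hx⟩ := lt_iSup_iff.1 this
    refine ⟨x, ?_⟩
    rw [← ENNReal.ofReal_lt_iff_lt_toReal hs0 (hnt x)]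
    rwa [ENNReal.lt_div_iff_mul_lt (.inl hA0) (.inl hAt)]
  have key := prekopaLeindler_real_of_le_one h0 h1 (u := fun x => (u x / a).toReal)
    (v := fun x => (v x / b).toReal) (w := fun x => (min 1 (w x / c)).toReal)
    (by fun_prop) (by fun_prop) (by fun_prop) (fun _ => ENNReal.toReal_nonneg)
    (fun x => ENNReal.toReal_le_of_le_ofReal zero_le_one (by simpa using ule x))
    (fun _ => ENNReal.toReal_nonneg)
    (fun x => ENNReal.toReal_le_of_le_ofReal zero_le_one (by simpa using vle x))
    (fun _ => ENNReal.toReal_nonneg) (hsup u a ha ha0 ub unt) (hsup v b hb hb0 vb vnt)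
    (by
      intro p q
      simp only [ENNReal.toReal_rpow, ← ENNReal.toReal_mul]
      refine ENNReal.toReal_mono (wnt _) (le_min ?_ ?_)
      · exact mul_le_one' (ENNReal.rpow_le_one (ule p) h1'.le) (ENNReal.rpow_le_one (vle q) h0.le)
      · rw [ENNReal.div_rpow_of_nonneg _ _ h1'.le, ENNReal.div_rpow_of_nonneg _ _ h0.le]
        calc u p ^ (1 - t) / a ^ (1 - t) * (v q ^ t / b ^ t)
            = (u p ^ (1 - t) * v q ^ t) / c := by
              rw [hc, div_eq_mul_inv, div_eq_mul_inv, div_eq_mul_inv, ENNReal.mul_inv]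
              · ring
              · left; simp [ha0, ub]
              · right; simp [hb0, vb]
          _ ≤ _ := by gcongr; exact h p q)
  simp only [ENNReal.ofReal_toReal (unt _), ENNReal.ofReal_toReal (vnt _),
    ENNReal.ofReal_toReal (wnt _)] at key
  have key2 : ((∫⁻ x, u x) / a) ^ (1 - t) * ((∫⁻ x, v x) / b) ^ t ≤ (∫⁻ x, w x) / c := by
    calc _ ≤ _ := ENNReal.rpow_mul_rpow_le_add h0 h1 _ _
      _ = ENNReal.ofReal (1 - t) * (∫⁻ x, u x / a) + ENNReal.ofReal t * (∫⁻ x, v x / b) := by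
        simp only [div_eq_mul_inv]
        rw [lintegral_mul_const _ hu, lintegral_mul_const _ hv]
      _ ≤ ∫⁻ x, min 1 (w x / c) := key
      _ ≤ ∫⁻ x, w x / c := lintegral_mono fun x => min_le_right _ _
      _ = _ := by
        simp only [div_eq_mul_inv]
        rw [lintegral_mul_const _ hw]
  rw [ENNReal.div_rpow_of_nonneg _ _ h1'.le, ENNReal.div_rpow_of_nonneg _ _ h0.le] at key2
  have e : (∫⁻ x, u x) ^ (1 - t) / a ^ (1 - t) * ((∫⁻ x, v x) ^ t / b ^ t)
            = ((∫⁻ x, u x) ^ (1 - t) * (∫⁻ x, v x) ^ t) / c := by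
    rw [hc, div_eq_mul_inv, div_eq_mul_inv, div_eq_mul_inv, ENNReal.mul_inv]
    · ring
    · left; simp [ha0, ub]
    · right; simp [hb0, vb]
  rw [e] at key2
  rwa [ENNReal.div_le_iff hc0 hct, ENNReal.div_mul_cancel hc0 hct] at key2

lemma prekopaLeindler_real : PrekopaLeindler (volume : Measure ℝ) := by
  intro t h0 h1 u v w hu hv hw h
  have h1' : 0 < 1 - t := sub_pos.2 h1
  rcases eq_or_ne (∫⁻ x, u x) 0 with hu0 | hu0
  · simp [hu0, h1']
  rcases eq_or_ne (∫⁻ x, v x) 0 with hv0 | hv0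
  · simp [hv0, h0]
  have key : ∀ n : ℕ, (∫⁻ x, min (u x) n) ^ (1 - t) * (∫⁻ x, min (v x) n) ^ t ≤ ∫⁻ x, w x := by
    intro n
    refine prekopaLeindler_real_of_bounded h0 h1 (by fun_prop) (by fun_prop) hw ?_ ?_ ?_
    · exact ne_top_of_le_ne_top (ENNReal.natCast_ne_top n) (iSup_le fun x => min_le_right _ _)
    · exact ne_top_of_le_ne_top (ENNReal.natCast_ne_top n) (iSup_le fun x => min_le_right _ _)
    · intro p q
      refine le_trans ?_ (h p q)
      gcongr <;> exact min_le_left _ _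
  have lim : ∀ f : ℝ → ℝ≥0∞, Measurable f →
      Filter.Tendsto (fun n : ℕ => ∫⁻ x, min (f x) n) Filter.atTop (nhds (∫⁻ x, f x)) := by
    intro f hf
    refine lintegral_tendsto_of_tendsto_of_monotone (fun n => by fun_prop) ?_ ?_
    · exact .of_forall fun x m n hmn => min_le_min_left _ (by exact_mod_cast hmn)
    · refine .of_forall fun x => ?_
      have := (tendsto_const_nhds (x := f x)).min ENNReal.tendsto_nat_nhds_top
      simpa using this
  refine le_of_tendsto' (ENNReal.Tendsto.mul
    ((ENNReal.continuous_rpow_const (y := 1 - t)).continuousAt.tendsto.comp (lim u hu)) (.inl ?_)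
    ((ENNReal.continuous_rpow_const (y := t)).continuousAt.tendsto.comp (lim v hv)) (.inl ?_)) key
  · simp [hu0, h1.le]
  · simp [hv0, h0.le]

lemma prekopaLeindler_pi (d : ℕ) : PrekopaLeindler (volume : Measure (Fin d → ℝ)) := by
  induction d with
  | zero =>
    intro t h0 h1 u v w hu hv hw h
    have : (volume : Measure (Fin 0 → ℝ)) = Measure.dirac 0 := by
      rw [volume_pi, Measure.pi_of_empty _ 0]
    rw [this, lintegral_dirac, lintegral_dirac, lintegral_dirac]
    simpa using h 0 0
  | succ d ih =>
    refine (prekopaLeindler_real.prod ih).of_measurePreserving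
      (volume_preserving_piFinSuccAbove (fun _ : Fin (d + 1) => ℝ) 0).symm ?_
    intro a b p q
    ext i
    refine Fin.cases ?_ (fun j => ?_) i <;> simp [MeasurableEquiv.piFinSuccAbove]

lemma prekopaLeindler_euclideanSpace (d : ℕ) :
    PrekopaLeindler (volume : Measure (EuclideanSpace ℝ (Fin d))) := by
  refine (prekopaLeindler_pi d).of_measurePreserving
    (EuclideanSpace.volume_preserving_symm_measurableEquiv_toLp (Fin d)).symm ?_
  intro a b p q
  ext i
  simp

lemma ConvexOn.exists_norm_le_of_integrable_exp_neg {d : ℕ} {f : EuclideanSpace ℝ (Fin d) → ℝ}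
    (hf : ConvexOn ℝ Set.univ f) (hi : Integrable (fun x => Real.exp (-f x))) :
    ∃ R > 0, ∀ z, f z ≤ f 0 + 1 → ‖z‖ ≤ R := by
  have hc : Continuous f := hf.locallyLipschitz.continuous
  obtain ⟨r, hr, hball⟩ : ∃ r > 0, ∀ x, ‖x‖ < r → f x ≤ f 0 + 1 := by
    have : ∀ᶠ x in nhds 0, f x < f 0 + 1 := hc.continuousAt.eventually_lt_const (by linarith)
    obtain ⟨r, hr, h⟩ := Metric.eventually_nhds_iff.1 this
    exact ⟨r, hr, fun x hx => (h (by simpa using hx)).le⟩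
  set K := {x | f x ≤ f 0 + 1}
  have hK : volume K < ⊤ := by
    have := hi.measure_ge_lt_top (Real.exp_pos (-(f 0 + 1)))
    refine (measure_mono fun x hx => ?_).trans_lt this
    have hx : f x ≤ f 0 + 1 := hx
    simpa using hx
  set V := volume (Metric.ball (0 : EuclideanSpace ℝ (Fin d)) (r / 2))
  have hV : V ≠ 0 := (Metric.measure_ball_pos _ _ (by positivity)).ne'
  obtain ⟨n, hn⟩ := ENNReal.exists_nat_mul_gt hV hK.ne
  refine ⟨2 * n * r + 1, by positivity, fun z hz => ?_⟩
  by_contra! hlt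
  have hzpos : 0 < ‖z‖ := lt_trans (by positivity) hlt
  set c : Fin n → EuclideanSpace ℝ (Fin d) := fun j => ((j : ℝ) * r / ‖z‖) • z
  have hd : Pairwise (Function.onFun Disjoint fun j => Metric.ball (c j) (r / 2)) := by
    intro i j hij
    refine Metric.ball_disjoint_ball ?_
    rw [dist_eq_norm, ← sub_smul, norm_smul, ← sub_div, ← sub_mul, Real.norm_eq_abs, abs_div,
      abs_mul, abs_of_pos hr, abs_of_pos hzpos, div_mul_cancel₀ _ hzpos.ne', add_halves]
    have : (1 : ℝ) ≤ |(i : ℝ) - j| := by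
      have h : ((i : ℕ) : ℤ) - (j : ℕ) ≠ 0 := by
        intro h; apply hij; ext; omega
      exact_mod_cast Int.one_le_abs h
    nlinarith
  have hsub : (⋃ j, Metric.ball (c j) (r / 2)) ⊆ K := by
    refine Set.iUnion_subset fun j p hp => ?_
    have hj : (j : ℝ) ≤ n := by exact_mod_cast j.2.le
    set s := (j : ℝ) * r / ‖z‖ with hs
    have s0 : 0 ≤ s := by positivity
    have s1 : s ≤ 1 / 2 := by
      rw [hs, div_le_iff₀ hzpos]
      nlinarith
    have hp : ‖p - s • z‖ < r / 2 := by simpa [dist_eq_norm] using hp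
    have e : p = s • z + (1 - s) • ((1 - s)⁻¹ • (p - s • z)) := by
      rw [smul_inv_smul₀ (by linarith)]; abel
    have hb : f ((1 - s)⁻¹ • (p - s • z)) ≤ f 0 + 1 := by
      apply hball
      rw [norm_smul, norm_inv, Real.norm_of_nonneg (by linarith), inv_mul_lt_iff₀ (by linarith)]
      nlinarith
    have := hf.2 (Set.mem_univ z) (Set.mem_univ ((1 - s)⁻¹ • (p - s • z))) s0
      (by linarith : 0 ≤ 1 - s) (by ring)
    rw [← e] at this
    change f p ≤ f 0 + 1
    simp only [smul_eq_mul] at this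
    nlinarith
  have : n * V ≤ volume K := by
    calc n * V = ∑ j : Fin n, volume (Metric.ball (c j) (r / 2)) := by
          simp [V, Measure.addHaar_ball_center]
      _ = volume (⋃ j, Metric.ball (c j) (r / 2)) := by
          rw [measure_iUnion hd (fun _ => measurableSet_ball), tsum_fintype]
      _ ≤ _ := measure_mono hsub
  exact absurd this (not_le.2 hn)

lemma ConvexOn.exists_linear_growth {d : ℕ} {f : EuclideanSpace ℝ (Fin d) → ℝ}
    (hf : ConvexOn ℝ Set.univ f) (hi : Integrable (fun x => Real.exp (-f x))) :
    ∃ a > 0, ∃ b, ∀ x, a * ‖x‖ - b ≤ f x := by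
  have hc : Continuous f := hf.locallyLipschitz.continuous
  obtain ⟨R, hR, h⟩ := hf.exists_norm_le_of_integrable_exp_neg hi
  set S := R + 1
  have hS : 0 < S := by positivity
  obtain ⟨x₀, -, hx₀⟩ := (isCompact_closedBall (0 : EuclideanSpace ℝ (Fin d)) S).exists_isMinOn
    ⟨0, by simp [hS.le]⟩ hc.continuousOn
  refine ⟨S⁻¹, by positivity, max (-f 0) (1 - f x₀), fun x => ?_⟩
  rcases le_or_gt ‖x‖ S with hx | hx
  · have h1 : f x₀ ≤ f x := hx₀ (by simpa using hx)
    have h2 : S⁻¹ * ‖x‖ ≤ 1 := by rwa [inv_mul_le_iff₀ hS, mul_one]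
    linarith [le_max_right (-f 0) (1 - f x₀)]
  · have hx0 : 0 < ‖x‖ := hS.trans hx
    set t := S / ‖x‖ with ht
    have t0 : 0 < t := by positivity
    have t1 : t ≤ 1 := by rw [ht, div_le_one hx0]; exact hx.le
    have h1 : f 0 + 1 < f (t • x) := by
      by_contra! hcon
      have := h _ hcon
      rw [norm_smul, Real.norm_of_nonneg t0.le, ht, div_mul_cancel₀ _ hx0.ne'] at this
      simp only [S] at this
      linarith
    have h2 := hf.2 (Set.mem_univ x) (Set.mem_univ 0) t0.le (by linarith : 0 ≤ 1 - t) (by ring)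
    simp only [smul_zero, add_zero, smul_eq_mul] at h2
    have h3 : 1 < t * (f x - f 0) := by linarith
    have h4 : S⁻¹ * ‖x‖ = t⁻¹ := by rw [ht, inv_div]; ring
    have h5 : t⁻¹ < f x - f 0 := by rwa [inv_lt_iff_one_lt_mul₀' t0]
    linarith [le_max_left (-f 0) (1 - f x₀)]

lemma ConvexOn.integrable_norm_sq_mul_exp_neg {d : ℕ} {f : EuclideanSpace ℝ (Fin d) → ℝ}
    (hf : ConvexOn ℝ Set.univ f) (hi : Integrable (fun x => Real.exp (-f x))) :
    Integrable (fun x => ‖x‖ ^ 2 * Real.exp (-f x)) := by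
  have hc : Continuous f := hf.locallyLipschitz.continuous
  obtain ⟨a, ha, b, hab⟩ := hf.exists_linear_growth hi
  have h1 : Integrable (fun x => 8 / a ^ 2 * Real.exp (f 0 + b) *
      Real.exp (-f ((2⁻¹ : ℝ) • x))) :=
    (hi.comp_smul (by norm_num : (2⁻¹ : ℝ) ≠ 0)).const_mul _
  refine h1.mono' (by fun_prop) (.of_forall fun x => ?_)
  rw [Real.norm_of_nonneg (by positivity)]
  have h2 := hf.2 (Set.mem_univ x) (Set.mem_univ 0) (by norm_num : (0 : ℝ) ≤ 2⁻¹)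
    (by norm_num : (0 : ℝ) ≤ 2⁻¹) (by norm_num)
  simp only [smul_zero, add_zero, smul_eq_mul] at h2
  have h3 := hab ((2⁻¹ : ℝ) • x)
  rw [norm_smul, Real.norm_of_nonneg (by norm_num)] at h3
  have h4 : Real.exp (-f x) ≤ Real.exp (f 0 + b) * Real.exp (-f ((2⁻¹ : ℝ) • x)) *
      Real.exp (-(a * ‖x‖ / 2)) := by
    rw [← Real.exp_add, ← Real.exp_add, Real.exp_le_exp]
    linarith
  have h5 : ‖x‖ ^ 2 * Real.exp (-(a * ‖x‖ / 2)) ≤ 8 / a ^ 2 := by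
    have := Real.quadratic_le_exp_of_nonneg (by positivity : 0 ≤ a * ‖x‖ / 2)
    rw [Real.exp_neg, ← div_eq_mul_inv, div_le_div_iff₀ (Real.exp_pos _) (by positivity)]
    have : 0 ≤ a * ‖x‖ := by positivity
    nlinarith
  calc ‖x‖ ^ 2 * Real.exp (-f x) ≤ ‖x‖ ^ 2 * (Real.exp (f 0 + b) * Real.exp (-f ((2⁻¹ : ℝ) • x)) *
      Real.exp (-(a * ‖x‖ / 2))) := by gcongr
    _ = (‖x‖ ^ 2 * Real.exp (-(a * ‖x‖ / 2))) * (Real.exp (f 0 + b) *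
      Real.exp (-f ((2⁻¹ : ℝ) • x))) := by ring
    _ ≤ 8 / a ^ 2 * (Real.exp (f 0 + b) * Real.exp (-f ((2⁻¹ : ℝ) • x))) := by gcongr
    _ = _ := by ring

/-- The Prékopa–Leindler inequality, in logarithmic form. -/
lemma log_integral_exp_concave {d : ℕ} {t : ℝ} (h0 : 0 < t) (h1 : t < 1)
    {U V W : EuclideanSpace ℝ (Fin d) → ℝ} (hU : Measurable U) (hV : Measurable V)
    (hW : Measurable W) (iU : Integrable (fun x => Real.exp (U x)))
    (iV : Integrable (fun x => Real.exp (V x))) (iW : Integrable (fun x => Real.exp (W x)))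
    (h : ∀ p q, (1 - t) * U p + t * V q ≤ W ((1 - t) • p + t • q)) :
    (1 - t) * Real.log (∫ x, Real.exp (U x)) + t * Real.log (∫ x, Real.exp (V x)) ≤
      Real.log (∫ x, Real.exp (W x)) := by
  have h1' : 0 < 1 - t := sub_pos.2 h1
  have key := prekopaLeindler_euclideanSpace d t h0 h1 (fun x => ENNReal.ofReal (Real.exp (U x)))
    (fun x => ENNReal.ofReal (Real.exp (V x))) (fun x => ENNReal.ofReal (Real.exp (W x)))
    (by fun_prop) (by fun_prop) (by fun_prop) (fun p q => by
      rw [ENNReal.ofReal_rpow_of_pos (Real.exp_pos _), ENNReal.ofReal_rpow_of_pos (Real.exp_pos _),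
        ← ENNReal.ofReal_mul (by positivity)]
      refine ENNReal.ofReal_le_ofReal ?_
      rw [← Real.exp_mul, ← Real.exp_mul, ← Real.exp_add, Real.exp_le_exp]
      linarith [h p q])
  have pU := integral_exp_pos iU
  have pV := integral_exp_pos iV
  have pW := integral_exp_pos iW
  rw [← ofReal_integral_eq_lintegral_ofReal iU (.of_forall fun _ => (Real.exp_pos _).le),
    ← ofReal_integral_eq_lintegral_ofReal iV (.of_forall fun _ => (Real.exp_pos _).le),
    ← ofReal_integral_eq_lintegral_ofReal iW (.of_forall fun _ => (Real.exp_pos _).le),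
    ENNReal.ofReal_rpow_of_pos pU, ENNReal.ofReal_rpow_of_pos pV,
    ← ENNReal.ofReal_mul (by positivity), ENNReal.ofReal_le_ofReal_iff pW.le] at key
  have := Real.log_le_log (by positivity) key
  rwa [Real.log_mul (by positivity) (by positivity), Real.log_rpow pU, Real.log_rpow pV] at this

/-- The normalizing constant of the Gibbs conditional density. -/
def gibbsPartition (h : EuclideanSpace ℝ (Fin d) → ℝ) (x : EuclideanSpace ℝ (Fin d)) : ℝ :=
  ∫ y, Real.exp (-h y - ‖x - y‖ ^ 2 / (2 * η))

/-- The Markov kernel `x ↦ π^{Y|X=x}`. -/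
def gibbsKernel (h : EuclideanSpace ℝ (Fin d) → ℝ) :
    ProbabilityTheory.Kernel (EuclideanSpace ℝ (Fin d)) (EuclideanSpace ℝ (Fin d)) :=
  ProbabilityTheory.Kernel.withDensity (ProbabilityTheory.Kernel.const _ volume)
    fun x y => ENNReal.ofReal (condYgivenX d η h x y)

lemma integral_le_log_integral_exp {X : Type*} [MeasurableSpace X] {m : Measure X}
    [IsProbabilityMeasure m] {φ : X → ℝ} (h : Integrable φ m)
    (he : Integrable (fun x => Real.exp (φ x)) m) :
    ∫ x, φ x ∂m ≤ Real.log (∫ x, Real.exp (φ x) ∂m) := by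
  rw [Real.le_log_iff_exp_le (integral_exp_pos he)]
  exact convexOn_exp.map_integral_le Real.continuous_exp.continuousOn isClosed_univ (by simp) h he

section
variable {d : ℕ} {η : ℝ} {h : EuclideanSpace ℝ (Fin d) → ℝ}

lemma integrable_gibbs (hη : 0 < η) (hc : Continuous h)
    (hi : Integrable (fun x => Real.exp (-h x))) (x : EuclideanSpace ℝ (Fin d)) :
    Integrable (fun y => Real.exp (-h y - ‖x - y‖ ^ 2 / (2 * η))) := by
  refine hi.mono' (by fun_prop) (.of_forall fun y => ?_)
  rw [Real.norm_of_nonneg (Real.exp_pos _).le, Real.exp_le_exp]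
  have : 0 ≤ ‖x - y‖ ^ 2 / (2 * η) := by positivity
  linarith

lemma gibbsPartition_pos (hη : 0 < η) (hc : Continuous h)
    (hi : Integrable (fun x => Real.exp (-h x))) (x : EuclideanSpace ℝ (Fin d)) :
    0 < gibbsPartition d η h x :=
  integral_exp_pos (integrable_gibbs hη hc hi x)

lemma condYgivenX_nonneg (hη : 0 < η) (hc : Continuous h)
    (hi : Integrable (fun x => Real.exp (-h x))) (x y : EuclideanSpace ℝ (Fin d)) :
    0 ≤ condYgivenX d η h x y :=
  div_nonneg (Real.exp_pos _).le (gibbsPartition_pos hη hc hi x).le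

lemma measurable_gibbsPartition (hc : Continuous h) : Measurable (gibbsPartition d η h) := by
  have : Continuous fun p : EuclideanSpace ℝ (Fin d) × EuclideanSpace ℝ (Fin d) =>
      Real.exp (-h p.2 - ‖p.1 - p.2‖ ^ 2 / (2 * η)) := by fun_prop
  exact this.stronglyMeasurable.integral_prod_right'.measurable

lemma measurable_condYgivenX (hc : Continuous h) :
    Measurable (Function.uncurry (condYgivenX d η h)) := by
  have h1 : Continuous fun p : EuclideanSpace ℝ (Fin d) × EuclideanSpace ℝ (Fin d) =>
      Real.exp (-h p.2 - ‖p.1 - p.2‖ ^ 2 / (2 * η)) := by fun_prop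
  exact h1.measurable.div ((measurable_gibbsPartition (η := η) hc).comp measurable_fst)

lemma gibbsKernel_apply (hc : Continuous h) (x : EuclideanSpace ℝ (Fin d)) :
    gibbsKernel d η h x = volume.withDensity fun y => ENNReal.ofReal (condYgivenX d η h x y) := by
  rw [gibbsKernel, ProbabilityTheory.Kernel.withDensity_apply _
    (measurable_condYgivenX hc).ennreal_ofReal, ProbabilityTheory.Kernel.const_apply]

lemma lintegral_condYgivenX (hη : 0 < η) (hc : Continuous h)
    (hi : Integrable (fun x => Real.exp (-h x))) (x : EuclideanSpace ℝ (Fin d)) :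
    ∫⁻ y, ENNReal.ofReal (condYgivenX d η h x y) = 1 := by
  have hint : Integrable (condYgivenX d η h x) := (integrable_gibbs hη hc hi x).div_const _
  rw [← ofReal_integral_eq_lintegral_ofReal hint (.of_forall (condYgivenX_nonneg hη hc hi x))]
  simp only [condYgivenX]
  rw [integral_div]
  have := (gibbsPartition_pos hη hc hi x).ne'
  rw [gibbsPartition] at this
  rw [div_self this, ENNReal.ofReal_one]

lemma isMarkovKernel_gibbsKernel (hη : 0 < η) (hc : Continuous h)
    (hi : Integrable (fun x => Real.exp (-h x))) :
    ProbabilityTheory.IsMarkovKernel (gibbsKernel d η h) :=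
  ⟨fun x => ⟨by
    rw [gibbsKernel_apply hc, withDensity_apply _ MeasurableSet.univ, setLIntegral_univ,
      lintegral_condYgivenX hη hc hi]⟩⟩

lemma integral_gibbsKernel (hη : 0 < η) (hc : Continuous h)
    (hi : Integrable (fun x => Real.exp (-h x))) (x : EuclideanSpace ℝ (Fin d))
    (φ : EuclideanSpace ℝ (Fin d) → ℝ) :
    ∫ y, φ y ∂(gibbsKernel d η h x) =
      (∫ y, Real.exp (-h y - ‖x - y‖ ^ 2 / (2 * η)) * φ y) / gibbsPartition d η h x := by
  have hm : Measurable (condYgivenX d η h x) := (measurable_condYgivenX hc).of_uncurry_left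
  rw [gibbsKernel_apply hc, integral_withDensity_eq_integral_toReal_smul hm.ennreal_ofReal
    (.of_forall fun _ => ENNReal.ofReal_lt_top), ← integral_div]
  refine integral_congr_ae (.of_forall fun y => ?_)
  simp only [ENNReal.toReal_ofReal (condYgivenX_nonneg hη hc hi x y), smul_eq_mul]
  rw [condYgivenX, gibbsPartition]
  ring

lemma integrable_gibbsKernel_iff (hη : 0 < η) (hc : Continuous h)
    (hi : Integrable (fun x => Real.exp (-h x))) (x : EuclideanSpace ℝ (Fin d))
    (φ : EuclideanSpace ℝ (Fin d) → ℝ) :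
    Integrable φ (gibbsKernel d η h x) ↔
      Integrable (fun y => Real.exp (-h y - ‖x - y‖ ^ 2 / (2 * η)) * φ y) := by
  have hm : Measurable (condYgivenX d η h x) := (measurable_condYgivenX hc).of_uncurry_left
  rw [gibbsKernel_apply hc, integrable_withDensity_iff_integrable_smul' hm.ennreal_ofReal
    (.of_forall fun _ => ENNReal.ofReal_lt_top)]
  have e : (fun y => (ENNReal.ofReal (condYgivenX d η h x y)).toReal • φ y) = fun y =>
      (Real.exp (-h y - ‖x - y‖ ^ 2 / (2 * η)) * φ y) * (gibbsPartition d η h x)⁻¹ := by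
    ext y
    simp only [ENNReal.toReal_ofReal (condYgivenX_nonneg hη hc hi x y), smul_eq_mul]
    rw [condYgivenX, gibbsPartition]
    ring
  rw [e, integrable_mul_const_iff (IsUnit.mk0 _ (inv_ne_zero (gibbsPartition_pos hη hc hi x).ne'))]

lemma norm_sub_affine_sq (t : ℝ) (x₀ x₁ p q : EuclideanSpace ℝ (Fin d)) :
    ‖((1 - t) • x₀ + t • x₁) - ((1 - t) • p + t • q)‖ ^ 2 =
      (1 - t) * ‖x₀ - p‖ ^ 2 + t * ‖x₁ - q‖ ^ 2 -
        t * (1 - t) * ‖(x₀ - p) - (x₁ - q)‖ ^ 2 := by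
  have e : ((1 - t) • x₀ + t • x₁) - ((1 - t) • p + t • q) =
      (1 - t) • (x₀ - p) + t • (x₁ - q) := by module
  rw [e, norm_add_sq_real, norm_sub_sq_real (x₀ - p) (x₁ - q), norm_smul, norm_smul, inner_smul_left,
    inner_smul_right]
  simp only [mul_pow, Real.norm_eq_abs, sq_abs, conj_trivial]
  ring

lemma log_gibbsPartition_concave (hη : 0 < η) (hh : ConvexOn ℝ Set.univ h)
    (hi : Integrable (fun x => Real.exp (-h x))) {t : ℝ} (h0 : 0 < t) (h1 : t < 1)
    (x₀ x₁ : EuclideanSpace ℝ (Fin d)) :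
    (1 - t) * Real.log (gibbsPartition d η h x₀) + t * Real.log (gibbsPartition d η h x₁) ≤
      Real.log (gibbsPartition d η h ((1 - t) • x₀ + t • x₁)) := by
  have hc : Continuous h := hh.locallyLipschitz.continuous
  refine log_integral_exp_concave h0 h1 (by fun_prop) (by fun_prop) (by fun_prop)
    (integrable_gibbs hη hc hi _) (integrable_gibbs hη hc hi _) (integrable_gibbs hη hc hi _)
    fun p q => ?_
  have := hh.2 (Set.mem_univ p) (Set.mem_univ q) (sub_pos.2 h1).le h0.le (by ring)
  simp only [smul_eq_mul] at this
  have h2 : ‖((1 - t) • x₀ + t • x₁) - ((1 - t) • p + t • q)‖ ^ 2 / (2 * η) ≤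
      (1 - t) * (‖x₀ - p‖ ^ 2 / (2 * η)) + t * (‖x₁ - q‖ ^ 2 / (2 * η)) := by
    rw [norm_sub_affine_sq, ← mul_div_assoc, ← mul_div_assoc, ← add_div]
    have : 0 ≤ t * (1 - t) * ‖(x₀ - p) - (x₁ - q)‖ ^ 2 :=
      mul_nonneg (mul_nonneg h0.le (sub_pos.2 h1).le) (by positivity)
    gcongr
    linarith
  linarith

end

section
variable {d : ℕ} {η : ℝ} {h : EuclideanSpace ℝ (Fin d) → ℝ}

lemma integrable_exp_of_abs_le {X : Type*} [MeasurableSpace X] {m : Measure X} [IsFiniteMeasure m]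
    {a : X → ℝ} (ha : Measurable a) {B : ℝ} (hB : ∀ y, |a y| ≤ B) :
    Integrable (fun y => Real.exp (a y)) m := by
  refine Integrable.of_bound (by fun_prop) (Real.exp B) (.of_forall fun y => ?_)
  rw [Real.norm_of_nonneg (Real.exp_pos _).le, Real.exp_le_exp]
  exact (le_abs_self _).trans (hB y)

lemma integrable_inner_gibbsKernel (hη : 0 < η) (hc : Continuous h)
    (hi : Integrable (fun x => Real.exp (-h x))) (x v : EuclideanSpace ℝ (Fin d)) :
    Integrable (fun y => inner ℝ v (y - x)) (gibbsKernel d η h x) := by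
  rw [integrable_gibbsKernel_iff hη hc hi]
  refine (hi.const_mul (‖v‖ * (1 + η / 2))).mono' (by fun_prop) (.of_forall fun y => ?_)
  rw [norm_mul, Real.norm_of_nonneg (Real.exp_pos _).le]
  set u := ‖x - y‖ ^ 2 / (2 * η) with hu
  have hu0 : 0 ≤ u := by positivity
  have h1 : ‖inner ℝ v (y - x)‖ ≤ ‖v‖ * (u + η / 2) := by
    refine (norm_inner_le_norm _ _).trans ?_
    rw [norm_sub_rev y x]
    gcongr
    have : u + η / 2 - ‖x - y‖ = (‖x - y‖ - η) ^ 2 / (2 * η) := by rw [hu]; field_simp; ring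
    have : 0 ≤ (‖x - y‖ - η) ^ 2 / (2 * η) := by positivity
    linarith
  have h2 : (u + η / 2) * Real.exp (-u) ≤ 1 + η / 2 := by
    have e1 : u * Real.exp (-u) ≤ 1 := by
      rw [Real.exp_neg, ← div_eq_mul_inv, div_le_one (Real.exp_pos _)]
      linarith [Real.add_one_le_exp u]
    have e2 : Real.exp (-u) ≤ 1 := Real.exp_le_one_iff.2 (by linarith)
    nlinarith
  have h3 : Real.exp (-h y - u) = Real.exp (-u) * Real.exp (-h y) := by
    rw [← Real.exp_add]; ring_nf
  rw [h3]
  calc Real.exp (-u) * Real.exp (-h y) * ‖inner ℝ v (y - x)‖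
      ≤ Real.exp (-u) * Real.exp (-h y) * (‖v‖ * (u + η / 2)) := by gcongr
    _ = ‖v‖ * ((u + η / 2) * Real.exp (-u)) * Real.exp (-h y) := by ring
    _ ≤ ‖v‖ * (1 + η / 2) * Real.exp (-h y) := by gcongr

lemma gibbsKernel_tilt_le (hη : 0 < η) (hc : Continuous h)
    (hi : Integrable (fun x => Real.exp (-h x))) (x x' : EuclideanSpace ℝ (Fin d))
    {a : EuclideanSpace ℝ (Fin d) → ℝ} (ha : Measurable a) {B : ℝ} (hB : ∀ y, |a y| ≤ B) :
    ∫ y, a y ∂(gibbsKernel d η h x) + (∫ y, inner ℝ (x' - x) (y - x) ∂(gibbsKernel d η h x)) / η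
      - ‖x' - x‖ ^ 2 / (2 * η) + Real.log (gibbsPartition d η h x) -
        Real.log (gibbsPartition d η h x') ≤
      Real.log (∫ y, Real.exp (a y) ∂(gibbsKernel d η h x')) := by
  have := isMarkovKernel_gibbsKernel hη hc hi
  have pZ := gibbsPartition_pos hη hc hi x
  have pZ' := gibbsPartition_pos hη hc hi x'
  set φ : EuclideanSpace ℝ (Fin d) → ℝ := fun y =>
    a y + inner ℝ (x' - x) (y - x) / η - ‖x' - x‖ ^ 2 / (2 * η) with hφ
  have e : ∀ y, Real.exp (-h y - ‖x - y‖ ^ 2 / (2 * η)) * Real.exp (φ y) =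
      Real.exp (-h y - ‖x' - y‖ ^ 2 / (2 * η)) * Real.exp (a y) := by
    intro y
    rw [← Real.exp_add, ← Real.exp_add]
    congr 1
    have : ‖x' - y‖ ^ 2 = ‖x' - x‖ ^ 2 - 2 * inner ℝ (x' - x) (y - x) + ‖x - y‖ ^ 2 := by
      rw [norm_sub_rev x y, ← norm_sub_sq_real]; congr 2; abel
    rw [this, hφ]
    field_simp
    ring
  have ia : Integrable a (gibbsKernel d η h x) :=
    Integrable.of_bound ha.aestronglyMeasurable B (.of_forall hB)
  have iφ : Integrable φ (gibbsKernel d η h x) :=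
    (ia.add ((integrable_inner_gibbsKernel hη hc hi x _).div_const η)).sub (integrable_const _)
  have iea : Integrable (fun y => Real.exp (a y)) (gibbsKernel d η h x') :=
    integrable_exp_of_abs_le ha hB
  have ieφ : Integrable (fun y => Real.exp (φ y)) (gibbsKernel d η h x) := by
    rw [integrable_gibbsKernel_iff hη hc hi] at iea ⊢
    simpa only [e] using iea
  have h1 := integral_le_log_integral_exp iφ ieφ
  have h2 : ∫ y, φ y ∂(gibbsKernel d η h x) = ∫ y, a y ∂(gibbsKernel d η h x) +
      (∫ y, inner ℝ (x' - x) (y - x) ∂(gibbsKernel d η h x)) / η - ‖x' - x‖ ^ 2 / (2 * η) := by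
    have i0 : Integrable (fun y => inner ℝ (x' - x) (y - x) / η) (gibbsKernel d η h x) :=
      (integrable_inner_gibbsKernel hη hc hi x _).div_const η
    have i1 : Integrable (fun y => a y + inner ℝ (x' - x) (y - x) / η) (gibbsKernel d η h x) :=
      ia.add i0
    rw [hφ, integral_sub i1 (integrable_const _), integral_add ia i0, integral_div]
    simp
  have h3 : ∫ y, Real.exp (φ y) ∂(gibbsKernel d η h x) =
      (∫ y, Real.exp (a y) ∂(gibbsKernel d η h x')) * gibbsPartition d η h x' /
        gibbsPartition d η h x := by
    rw [integral_gibbsKernel hη hc hi, integral_gibbsKernel hη hc hi, div_mul_cancel₀ _ pZ'.ne']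
    simp only [e]
  rw [h2, h3, Real.log_div (mul_pos (integral_exp_pos iea) pZ').ne' pZ.ne',
    Real.log_mul (integral_exp_pos iea).ne' pZ'.ne'] at h1
  linarith

lemma log_gibbsPartition_sub_le (hη : 0 < η) (hh : ConvexOn ℝ Set.univ h)
    (hi : Integrable (fun x => Real.exp (-h x))) (x x' : EuclideanSpace ℝ (Fin d)) :
    Real.log (gibbsPartition d η h x') - Real.log (gibbsPartition d η h x) ≤
      (∫ y, inner ℝ (x' - x) (y - x) ∂(gibbsKernel d η h x)) / η := by
  have hc : Continuous h := hh.locallyLipschitz.continuous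
  have := isMarkovKernel_gibbsKernel hη hc hi
  set M := ∫ y, inner ℝ (x' - x) (y - x) ∂(gibbsKernel d η h x)
  have key : ∀ t > 0, Real.log (gibbsPartition d η h x') - Real.log (gibbsPartition d η h x) ≤
      M / η + t * (‖x' - x‖ ^ 2 / (2 * η)) := by
    intro t ht
    set z := x - t • (x' - x) with hz
    have h1 := gibbsKernel_tilt_le hη hc hi x z (a := fun _ => 0) measurable_const
      (B := 0) (by simp)
    have ezx : z - x = (-t) • (x' - x) := by rw [hz]; module
    simp only [ezx, inner_smul_left, integral_const_mul, norm_smul, mul_pow, Real.norm_eq_abs,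
      sq_abs, conj_trivial, integral_zero, Real.exp_zero, integral_const, probReal_univ,
      smul_eq_mul, mul_one, Real.log_one] at h1
    have h2 := log_gibbsPartition_concave hη hh hi (t := t / (1 + t)) (by positivity)
      (by rw [div_lt_one (by positivity)]; linarith) z x'
    have ex : (1 - t / (1 + t)) • z + (t / (1 + t)) • x' = x := by
      have : 1 - t / (1 + t) = 1 / (1 + t) := by field_simp; ring
      rw [this, hz]
      match_scalars <;> field_simp <;> ring
    rw [ex] at h2
    have e1 : 1 - t / (1 + t) = 1 / (1 + t) := by field_simp; ring
    rw [e1] at h2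
    set L := Real.log (gibbsPartition d η h x)
    set L' := Real.log (gibbsPartition d η h x')
    set Lz := Real.log (gibbsPartition d η h z)
    have h3 : Lz + t * L' ≤ (1 + t) * L := by
      have := mul_le_mul_of_nonneg_left h2 (by positivity : 0 ≤ 1 + t)
      have e : (1 + t) * (1 / (1 + t) * Lz + t / (1 + t) * L') = Lz + t * L' := by field_simp
      linarith
    have h4 : t * (L' - L) ≤ t * (M / η + t * (‖x' - x‖ ^ 2 / (2 * η))) := by
      have e2 : -t * M / η = - (t * (M / η)) := by ring
      have e3 : (-t) ^ 2 * ‖x' - x‖ ^ 2 / (2 * η) = t * (t * (‖x' - x‖ ^ 2 / (2 * η))) := by ring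
      change 0 + -t * M / η - (-t) ^ 2 * ‖x' - x‖ ^ 2 / (2 * η) + L - Lz ≤ 0 at h1
      rw [e2, e3] at h1
      linarith
    exact le_of_mul_le_mul_left h4 ht
  set D := ‖x' - x‖ ^ 2 / (2 * η)
  have hD : 0 ≤ D := by positivity
  refine le_of_forall_pos_le_add fun ε hε => ?_
  refine (key (ε / (D + 1)) (by positivity)).trans ?_
  gcongr
  rw [div_mul_eq_mul_div, div_le_iff₀ (by positivity)]
  nlinarith

/-- A reverse transport inequality for one Gibbs step. -/
lemma gibbsKernel_logHarnack (hη : 0 < η) (hh : ConvexOn ℝ Set.univ h)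
    (hi : Integrable (fun x => Real.exp (-h x))) (x x' : EuclideanSpace ℝ (Fin d))
    {a : EuclideanSpace ℝ (Fin d) → ℝ} (ha : Measurable a) {B : ℝ} (hB : ∀ y, |a y| ≤ B) :
    ∫ y, a y ∂(gibbsKernel d η h x) ≤
      Real.log (∫ y, Real.exp (a y) ∂(gibbsKernel d η h x')) + ‖x - x'‖ ^ 2 / (2 * η) := by
  have h1 := gibbsKernel_tilt_le hη hh.locallyLipschitz.continuous hi x x' ha hB
  have h2 := log_gibbsPartition_sub_le hη hh hi x x'
  rw [norm_sub_rev x x']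
  linarith

/-- One Gibbs step is a contraction in `W₂`, in dual form. -/
lemma gibbsKernel_contraction (hη : 0 < η) (hh : ConvexOn ℝ Set.univ h)
    (hi : Integrable (fun x => Real.exp (-h x))) (x x' : EuclideanSpace ℝ (Fin d)) {c : ℝ}
    (hc0 : 0 < c) {a b : EuclideanSpace ℝ (Fin d) → ℝ} (ha : Measurable a) (hb : Measurable b)
    {A B : ℝ} (hA : ∀ y, |a y| ≤ A) (hB : ∀ y, |b y| ≤ B)
    (hab : ∀ p q, a p ≤ b q + c * ‖p - q‖ ^ 2) :
    ∫ y, a y ∂(gibbsKernel d η h x) ≤ ∫ y, b y ∂(gibbsKernel d η h x') + c * ‖x - x'‖ ^ 2 := by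
  have hc : Continuous h := hh.locallyLipschitz.continuous
  have := isMarkovKernel_gibbsKernel hη hc hi
  have pZ := gibbsPartition_pos hη hc hi x'
  have key : ∀ t : ℝ, 0 < t → t < 1 →
      t * ∫ y, a y ∂(gibbsKernel d η h x) ≤
        t * (∫ y, b y ∂(gibbsKernel d η h x')) + c * ‖x - x'‖ ^ 2 := by
    intro t h0 h1
    have h1' : 0 < 1 - t := sub_pos.2 h1
    set θ := t / (2 * η * c) with hθ
    have θ0 : 0 < θ := by positivity
    set s := (1 - t) * θ / t with hs
    have hs0 : 0 < s := by positivity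
    have hA' : ∀ y, |θ * a y| ≤ θ * A := fun y => by
      rw [abs_mul, abs_of_pos θ0]; gcongr; exact hA y
    have hB' : ∀ y, |-s * b y| ≤ s * B := fun y => by
      rw [abs_mul, abs_neg, abs_of_pos hs0]; gcongr; exact hB y
    have m1 : Measurable fun y => θ * a y := by fun_prop
    have m2 : Measurable fun y => -s * b y := by fun_prop
    have i1 : Integrable (fun y => Real.exp (θ * a y)) (gibbsKernel d η h x') :=
      integrable_exp_of_abs_le m1 hA'
    have i2 : Integrable (fun y => Real.exp (-s * b y)) (gibbsKernel d η h x') :=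
      integrable_exp_of_abs_le m2 hB'
    have H1 := gibbsKernel_logHarnack hη hh hi x x' m1 hA'
    rw [integral_const_mul] at H1
    have ib : Integrable (fun y => -s * b y) (gibbsKernel d η h x') :=
      Integrable.of_bound m2.aestronglyMeasurable (s * B) (.of_forall hB')
    have H2 := integral_le_log_integral_exp ib i2
    rw [integral_const_mul] at H2
    have H3 := log_integral_exp_concave h0 h1
      (U := fun y => -h y - ‖x' - y‖ ^ 2 / (2 * η) + θ * a y)
      (V := fun y => -h y - ‖x' - y‖ ^ 2 / (2 * η) + -s * b y)
      (W := fun y => -h y - ‖x' - y‖ ^ 2 / (2 * η)) (by fun_prop) (by fun_prop) (by fun_prop)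
      (by simpa only [Real.exp_add] using (integrable_gibbsKernel_iff hη hc hi x' _).1 i1)
      (by simpa only [Real.exp_add] using (integrable_gibbsKernel_iff hη hc hi x' _).1 i2)
      (integrable_gibbs hη hc hi x')
      (by
        intro p q
        have k1 := hh.2 (Set.mem_univ p) (Set.mem_univ q) h1'.le h0.le (by ring)
        simp only [smul_eq_mul] at k1
        have k2 : ‖x' - ((1 - t) • p + t • q)‖ ^ 2 =
            (1 - t) * ‖x' - p‖ ^ 2 + t * ‖x' - q‖ ^ 2 - t * (1 - t) * ‖p - q‖ ^ 2 := by
          have := norm_sub_affine_sq t x' x' p q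
          have e : (1 - t) • x' + t • x' = x' := by module
          have e' : (x' - p) - (x' - q) = -(p - q) := by abel
          rwa [e, e', norm_neg] at this
        have k3 : (1 - t) * (θ * a p) + t * (-s * b q) ≤
            t * (1 - t) * ‖p - q‖ ^ 2 / (2 * η) := by
          have e : t * s = (1 - t) * θ := by rw [hs]; field_simp
          have e' : t * (1 - t) * ‖p - q‖ ^ 2 / (2 * η) = (1 - t) * θ * (c * ‖p - q‖ ^ 2) := by
            rw [hθ]; field_simp
          have : (1 - t) * θ * a p ≤ (1 - t) * θ * (b q + c * ‖p - q‖ ^ 2) := by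
            gcongr; exact hab p q
          have e2 : t * (-s * b q) = - ((1 - t) * θ * b q) := by rw [← e]; ring
          rw [e', e2]
          linarith
        rw [k2]
        have e4 : ((1 - t) * ‖x' - p‖ ^ 2 + t * ‖x' - q‖ ^ 2 - t * (1 - t) * ‖p - q‖ ^ 2) /
            (2 * η) = (1 - t) * (‖x' - p‖ ^ 2 / (2 * η)) + t * (‖x' - q‖ ^ 2 / (2 * η)) -
              t * (1 - t) * ‖p - q‖ ^ 2 / (2 * η) := by ring
        rw [e4]
        linarith)
    have E : ∀ φ : EuclideanSpace ℝ (Fin d) → ℝ,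
        Integrable (fun y => Real.exp (φ y)) (gibbsKernel d η h x') →
        Real.log (∫ y, Real.exp (-h y - ‖x' - y‖ ^ 2 / (2 * η) + φ y)) =
        Real.log (∫ y, Real.exp (φ y) ∂(gibbsKernel d η h x')) +
          Real.log (gibbsPartition d η h x') := by
      intro φ hφ
      rw [← Real.log_mul (integral_exp_pos hφ).ne' pZ.ne', integral_gibbsKernel hη hc hi,
        div_mul_cancel₀ _ pZ.ne']
      simp only [Real.exp_add]
    rw [E _ i1, E _ i2] at H3
    change _ ≤ Real.log (gibbsPartition d η h x') at H3
    set Ia := ∫ y, a y ∂(gibbsKernel d η h x)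
    set Ib := ∫ y, b y ∂(gibbsKernel d η h x')
    set l1 := Real.log (∫ y, Real.exp (θ * a y) ∂(gibbsKernel d η h x'))
    set l2 := Real.log (∫ y, Real.exp (-s * b y) ∂(gibbsKernel d η h x'))
    have F1 : (1 - t) * l1 + t * l2 ≤ 0 := by linarith
    have F2 : t * (-s * Ib) ≤ t * l2 := by gcongr
    have F3 : t * (-s * Ib) = - ((1 - t) * (θ * Ib)) := by rw [hs]; field_simp
    have F4 : (1 - t) * l1 ≤ (1 - t) * (θ * Ib) := by linarith
    have F5 : l1 ≤ θ * Ib := le_of_mul_le_mul_left F4 h1'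
    have F6 : θ * Ia ≤ θ * Ib + ‖x - x'‖ ^ 2 / (2 * η) := by linarith
    have F7 := mul_le_mul_of_nonneg_left F6 (by positivity : 0 ≤ 2 * η * c)
    have G1 : 2 * η * c * (θ * Ia) = t * Ia := by rw [hθ]; field_simp
    have G2 : 2 * η * c * (θ * Ib + ‖x - x'‖ ^ 2 / (2 * η)) = t * Ib + c * ‖x - x'‖ ^ 2 := by
      rw [hθ]; field_simp
    linarith
  have lim : ∀ I : ℝ, Filter.Tendsto (fun t : ℝ => t * I) (nhdsWithin 1 (Set.Iio 1)) (nhds I) := by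
    intro I
    have : Filter.Tendsto (fun t : ℝ => t * I) (nhds 1) (nhds (1 * I)) :=
      (continuous_id.mul continuous_const).tendsto _
    rw [one_mul] at this
    exact this.mono_left nhdsWithin_le_nhds
  refine le_of_tendsto_of_tendsto (lim _) ((lim _).add_const _) ?_
  have : ∀ᶠ t : ℝ in nhdsWithin 1 (Set.Iio 1), t ∈ Set.Ioo 0 1 :=
    Ioo_mem_nhdsLT one_pos
  filter_upwards [this] with t ht
  exact key t ht.1 ht.2

end

section
variable {d : ℕ} {η : ℝ} {h : EuclideanSpace ℝ (Fin d) → ℝ}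

/-- The log-Harnack inequality with constant `c` for a kernel, tested on bounded functions. -/
def LogHarnack {E : Type*} [NormedAddCommGroup E] [MeasurableSpace E] {F : Type*}
    [MeasurableSpace F] (c : ℝ) (κ : ProbabilityTheory.Kernel E F) : Prop :=
  ∀ ψ : F → ℝ, Measurable ψ → ∀ B : ℝ, (∀ y, |ψ y| ≤ B) → ∀ x x' : E,
    ∫ y, ψ y ∂(κ x) ≤ Real.log (∫ y, Real.exp (ψ y) ∂(κ x')) + c * ‖x - x'‖ ^ 2

lemma abs_integral_le_of_abs_le {X : Type*} [MeasurableSpace X] {m : Measure X}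
    [IsProbabilityMeasure m] {a : X → ℝ} {B : ℝ} (hB : ∀ y, |a y| ≤ B) : |∫ y, a y ∂m| ≤ B := by
  have := norm_integral_le_of_norm_le_const (μ := m) (f := a) (C := B) (.of_forall hB)
  simpa using this

lemma abs_log_integral_exp_le {X : Type*} [MeasurableSpace X] {m : Measure X}
    [IsProbabilityMeasure m] {a : X → ℝ} (ha : Measurable a) {B : ℝ} (hB : ∀ y, |a y| ≤ B) :
    |Real.log (∫ y, Real.exp (a y) ∂m)| ≤ B := by
  have i := integrable_exp_of_abs_le (m := m) ha hB
  have p := integral_exp_pos i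
  rw [abs_le]
  constructor
  · refine le_trans ?_ (integral_le_log_integral_exp
      (Integrable.of_bound ha.aestronglyMeasurable B (.of_forall hB)) i)
    exact (abs_le.1 (abs_integral_le_of_abs_le hB)).1
  · rw [Real.log_le_iff_le_exp p]
    calc ∫ y, Real.exp (a y) ∂m ≤ ∫ _, Real.exp B ∂m :=
          integral_mono i (integrable_const _) fun y => Real.exp_le_exp.2 (le_of_abs_le (hB y))
      _ = Real.exp B := by simp

lemma measurable_integral_kernel {E F : Type*} [MeasurableSpace E] [MeasurableSpace F]
    (κ : ProbabilityTheory.Kernel E F) [ProbabilityTheory.IsSFiniteKernel κ] {a : F → ℝ}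
    (ha : Measurable a) : Measurable fun x => ∫ y, a y ∂(κ x) :=
  (MeasureTheory.StronglyMeasurable.integral_kernel (κ := κ) ha.stronglyMeasurable).measurable

lemma LogHarnack.mono {E : Type*} [NormedAddCommGroup E] [MeasurableSpace E] {F : Type*}
    [MeasurableSpace F] {c c' : ℝ} {κ : ProbabilityTheory.Kernel E F} (H : LogHarnack c κ)
    (hc : c ≤ c') : LogHarnack c' κ := fun ψ hψ B hB x x' =>
  (H ψ hψ B hB x x').trans (by gcongr)

lemma logHarnack_gibbsKernel (hη : 0 < η) (hh : ConvexOn ℝ Set.univ h)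
    (hi : Integrable (fun x => Real.exp (-h x))) :
    LogHarnack (1 / (2 * η)) (gibbsKernel d η h) := fun ψ hψ B hB x x' => by
  have := gibbsKernel_logHarnack hη hh hi x x' hψ hB
  rwa [div_eq_inv_mul, ← one_div] at this

lemma integral_exp_kernel_comp {E F G : Type*} [MeasurableSpace E] [MeasurableSpace F]
    [MeasurableSpace G] {κ : ProbabilityTheory.Kernel E F} {κ' : ProbabilityTheory.Kernel F G}
    [ProbabilityTheory.IsMarkovKernel κ] [ProbabilityTheory.IsMarkovKernel κ'] {ψ : G → ℝ}
    (hψ : Measurable ψ) {B : ℝ} (hB : ∀ y, |ψ y| ≤ B) (x : E) :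
    ∫ z, ψ z ∂((ProbabilityTheory.Kernel.comp κ' κ) x) = ∫ y, ∫ z, ψ z ∂(κ' y) ∂(κ x) := by
  refine ProbabilityTheory.Kernel.integral_comp ?_
  exact Integrable.of_bound hψ.aestronglyMeasurable B (.of_forall hB)

lemma LogHarnack.comp_gibbsKernel {F : Type*} [MeasurableSpace F] (hη : 0 < η)
    (hh : ConvexOn ℝ Set.univ h)
    (hi : Integrable (fun x => Real.exp (-h x)))
    {κ : ProbabilityTheory.Kernel (EuclideanSpace ℝ (Fin d)) F}
    [ProbabilityTheory.IsMarkovKernel κ] {N : ℝ} (hN : 0 < N)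
    (H : LogHarnack (1 / (2 * η * N)) κ) :
    LogHarnack (1 / (2 * η * (N + 1))) (ProbabilityTheory.Kernel.comp κ (gibbsKernel d η h)) := by
  intro ψ hψ B hB x x'
  have := isMarkovKernel_gibbsKernel hη hh.locallyLipschitz.continuous hi
  have hme : Measurable fun z => Real.exp (ψ z) := by fun_prop
  have hBe : ∀ z, |Real.exp (ψ z)| ≤ Real.exp B := fun z => by
    rw [abs_of_pos (Real.exp_pos _)]; exact Real.exp_le_exp.2 (le_of_abs_le (hB z))
  rw [integral_exp_kernel_comp hψ hB, integral_exp_kernel_comp hme hBe]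
  set a := fun y => ∫ z, ψ z ∂(κ y)
  set b := fun y => Real.log (∫ z, Real.exp (ψ z) ∂(κ y)) with hb
  have ma : Measurable a := measurable_integral_kernel κ hψ
  have mb : Measurable b := (measurable_integral_kernel κ hme).log
  have bb : ∀ y, |b y| ≤ B := fun y => abs_log_integral_exp_le hψ hB
  have eb : ∀ y, ∫ z, Real.exp (ψ z) ∂(κ y) = Real.exp (b y) := fun y => by
    rw [hb, Real.exp_log (integral_exp_pos (integrable_exp_of_abs_le hψ hB))]
  simp only [eb]
  set z := x' + (1 / (N + 1)) • (x - x') with hz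
  have h1 := gibbsKernel_contraction hη hh hi x z (c := 1 / (2 * η * N)) (by positivity) ma mb
    (fun y => abs_integral_le_of_abs_le hB) bb (fun p q => H ψ hψ B hB p q)
  have h2 := gibbsKernel_logHarnack hη hh hi z x' mb bb
  have e1 : x - z = (N / (N + 1)) • (x - x') := by
    rw [hz]; match_scalars <;> field_simp <;> ring
  have e2 : z - x' = (1 / (N + 1)) • (x - x') := by rw [hz]; abel
  rw [e1, norm_smul, mul_pow, Real.norm_eq_abs, sq_abs] at h1
  rw [e2, norm_smul, mul_pow, Real.norm_eq_abs, sq_abs] at h2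
  have e3 : 1 / (2 * η * N) * ((N / (N + 1)) ^ 2 * ‖x - x'‖ ^ 2) +
      (1 / (N + 1)) ^ 2 * ‖x - x'‖ ^ 2 / (2 * η) = 1 / (2 * η * (N + 1)) * ‖x - x'‖ ^ 2 := by
    field_simp
  linarith

/-- One full sweep of the Gibbs sampler, as a kernel. -/
def sweepKernel (d : ℕ) (η : ℝ) (f g : EuclideanSpace ℝ (Fin d) → ℝ) :
    ProbabilityTheory.Kernel (EuclideanSpace ℝ (Fin d)) (EuclideanSpace ℝ (Fin d)) :=
  ProbabilityTheory.Kernel.comp (gibbsKernel d η f) (gibbsKernel d η g)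

/-- The law of the `X`-coordinate after `k` sweeps, as a kernel in the starting point. -/
def iterSweep (d : ℕ) (η : ℝ) (f g : EuclideanSpace ℝ (Fin d) → ℝ) :
    ℕ → ProbabilityTheory.Kernel (EuclideanSpace ℝ (Fin d)) (EuclideanSpace ℝ (Fin d))
  | 0 => ProbabilityTheory.Kernel.id
  | k + 1 => ProbabilityTheory.Kernel.comp (iterSweep d η f g k) (sweepKernel d η f g)

lemma iterSweep_succ' (f g : EuclideanSpace ℝ (Fin d) → ℝ) (k : ℕ) :
    iterSweep d η f g (k + 1) =
      ProbabilityTheory.Kernel.comp (sweepKernel d η f g) (iterSweep d η f g k) := by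
  induction k with
  | zero => simp [iterSweep]
  | succ k ih =>
    rw [iterSweep, ih, ProbabilityTheory.Kernel.comp_assoc, ← iterSweep, ih]

variable {f g : EuclideanSpace ℝ (Fin d) → ℝ}

lemma isMarkovKernel_sweepKernel (hη : 0 < η) (hf : Continuous f) (hg : Continuous g)
    (hfi : Integrable (fun x => Real.exp (-f x))) (hgi : Integrable (fun x => Real.exp (-g x))) :
    ProbabilityTheory.IsMarkovKernel (sweepKernel d η f g) := by
  have := isMarkovKernel_gibbsKernel hη hf hfi
  have := isMarkovKernel_gibbsKernel hη hg hgi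
  rw [sweepKernel]
  infer_instance

lemma isMarkovKernel_iterSweep (hη : 0 < η) (hf : Continuous f) (hg : Continuous g)
    (hfi : Integrable (fun x => Real.exp (-f x))) (hgi : Integrable (fun x => Real.exp (-g x)))
    (k : ℕ) : ProbabilityTheory.IsMarkovKernel (iterSweep d η f g k) := by
  have := isMarkovKernel_sweepKernel hη hf hg hfi hgi
  induction k with
  | zero => rw [iterSweep]; infer_instance
  | succ k ih => rw [iterSweep]; infer_instance

lemma logHarnack_iterSweep (hη : 0 < η) (hf : ConvexOn ℝ Set.univ f) (hg : ConvexOn ℝ Set.univ g)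
    (hfi : Integrable (fun x => Real.exp (-f x))) (hgi : Integrable (fun x => Real.exp (-g x)))
    (k : ℕ) : LogHarnack (1 / (2 * η * (2 * k + 2))) (iterSweep d η f g (k + 1)) := by
  have Mf := isMarkovKernel_gibbsKernel hη hf.locallyLipschitz.continuous hfi
  have Mg := isMarkovKernel_gibbsKernel hη hg.locallyLipschitz.continuous hgi
  have := isMarkovKernel_iterSweep hη hf.locallyLipschitz.continuous
    hg.locallyLipschitz.continuous hfi hgi
  induction k with
  | zero =>
    have H : LogHarnack (1 / (2 * η * 1)) (gibbsKernel d η f) := by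
      simpa using logHarnack_gibbsKernel hη hf hfi
    have := LogHarnack.comp_gibbsKernel hη hg hgi one_pos H
    simp only [iterSweep, ProbabilityTheory.Kernel.id_comp, sweepKernel]
    convert this using 3
    norm_num
  | succ k ih =>
    have H := LogHarnack.comp_gibbsKernel hη hg hgi (by positivity)
      (LogHarnack.comp_gibbsKernel hη hf hfi (by positivity) ih)
    rw [iterSweep, sweepKernel, ← ProbabilityTheory.Kernel.comp_assoc]
    convert H using 3
    push_cast
    ring

end

/-- A dual criterion for an upper bound on the Kullback–Leibler divergence. -/
lemma klDiv_le_of_forall_integral_le {X : Type*} [MeasurableSpace X] {ν ρ : Measure X}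
    [IsProbabilityMeasure ν] [IsProbabilityMeasure ρ] {C : ℝ}
    (H : ∀ ψ : X → ℝ, Measurable ψ → ∀ B : ℝ, (∀ x, |ψ x| ≤ B) →
      ∫ x, ψ x ∂ν ≤ Real.log (∫ x, Real.exp (ψ x) ∂ρ) + C) :
    klDiv ν ρ ≤ ENNReal.ofReal C := by
  have hac : ν ≪ ρ := by
    refine Measure.AbsolutelyContinuous.mk fun A hA hρ => ?_
    have hn : ∀ n : ℕ, (n : ℝ) * ν.real A ≤ C := by
      intro n
      have h := H (A.indicator fun _ => (n : ℝ)) (measurable_const.indicator hA) n fun x => by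
        by_cases hx : x ∈ A <;> simp [hx]
      have e : ∫ x, Real.exp (A.indicator (fun _ => (n : ℝ)) x) ∂ρ = 1 := by
        have : (fun x => Real.exp (A.indicator (fun _ => (n : ℝ)) x)) =ᵐ[ρ] fun _ => 1 := by
          have : ∀ᵐ x ∂ρ, x ∉ A := measure_eq_zero_iff_ae_notMem.1 hρ
          filter_upwards [this] with x hx
          simp [hx]
        rw [integral_congr_ae this]
        simp
      rw [e, integral_indicator_const _ hA] at h
      simpa [mul_comm] using h
    have h0 : ν.real A = 0 := by
      by_contra hne
      have hp : 0 < ν.real A := lt_of_le_of_ne measureReal_nonneg (Ne.symm hne)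
      obtain ⟨n, hn'⟩ := exists_nat_gt (C / ν.real A)
      rw [div_lt_iff₀ hp] at hn'
      linarith [hn n]
    exact (measureReal_eq_zero_iff).1 h0
  rw [klDiv, if_pos hac]
  set φ : X → ℝ := fun x => (ν.rnDeriv ρ x).toReal with hφ
  have mφ : Measurable φ := (Measure.measurable_rnDeriv _ _).ennreal_toReal
  have φ0 : ∀ x, 0 ≤ φ x := fun x => ENNReal.toReal_nonneg
  have iφ : Integrable φ ρ := Measure.integrable_toReal_rnDeriv
  set c : ℕ → X → ℝ := fun n x => max (1 / ((n : ℝ) + 1)) (min (φ x) ((n : ℝ) + 1)) with hc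
  have c_pos : ∀ (n : ℕ) (x : X), 0 < c n x := fun n x => lt_max_of_lt_left (by positivity)
  have c_le : ∀ (n : ℕ) (x : X), c n x ≤ (n : ℝ) + 1 := fun n x => by
    refine max_le ?_ (min_le_right _ _)
    rw [div_le_iff₀ (by positivity)]
    nlinarith [(Nat.cast_nonneg n : (0 : ℝ) ≤ n)]
  have c_ge : ∀ (n : ℕ) (x : X), 1 / ((n : ℝ) + 1) ≤ c n x := fun n x => le_max_left _ _
  have mc : ∀ n : ℕ, Measurable (c n) := fun n => by fun_prop
  have ic : ∀ n : ℕ, Integrable (c n) ρ := fun n =>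
    Integrable.of_bound (mc n).aestronglyMeasurable ((n : ℝ) + 1) (.of_forall fun x => by
      rw [Real.norm_of_nonneg (c_pos n x).le]; exact c_le n x)
  have lb : ∀ (n : ℕ) (x : X), |Real.log (c n x)| ≤ Real.log ((n : ℝ) + 1) := fun n x => by
    rw [abs_le]
    constructor
    · rw [← Real.log_inv, ← one_div]
      exact Real.log_le_log (by positivity) (c_ge n x)
    · exact Real.log_le_log (c_pos n x) (c_le n x)
  have mlc : ∀ n : ℕ, Measurable fun x => Real.log (c n x) := fun n => (mc n).log
  have iφl : ∀ n : ℕ, Integrable (fun x => φ x * Real.log (c n x)) ρ := fun n =>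
    iφ.mul_bdd (mlc n).aestronglyMeasurable (.of_forall (lb n))
  set F : ℕ → X → ℝ := fun n x => φ x * Real.log (c n x) - c n x + 1 with hF
  have iF : ∀ n : ℕ, Integrable (F n) ρ := fun n => ((iφl n).sub (ic n)).add (integrable_const _)
  have mF : ∀ n : ℕ, Measurable (F n) := fun n => ((mφ.mul (mlc n)).sub (mc n)).add_const _
  have F0 : ∀ (n : ℕ) (x : X), 0 ≤ F n x := by
    intro n x
    have h1 : c n x * Real.log (c n x) ≤ φ x * Real.log (c n x) := by
      rcases le_total (φ x) (1 / ((n : ℝ) + 1)) with h | h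
      · have hcx : c n x = 1 / ((n : ℝ) + 1) := max_eq_left ((min_le_left _ _).trans h)
        rw [hcx]
        refine mul_le_mul_of_nonpos_right h (Real.log_nonpos (by positivity) ?_)
        rw [div_le_iff₀ (by positivity)]
        linarith [(Nat.cast_nonneg n : (0 : ℝ) ≤ n)]
      · rcases le_total (φ x) ((n : ℝ) + 1) with h' | h'
        · have hcx : c n x = φ x := by rw [hc]; simp only [min_eq_left h', max_eq_right h]
          rw [hcx]
        · have hcx : c n x = (n : ℝ) + 1 := by
            refine le_antisymm (c_le n x) ?_
            rw [hc]; simp only [min_eq_right h']; exact le_max_right _ _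
          rw [hcx]
          exact mul_le_mul_of_nonneg_right h' (Real.log_nonneg (by
            linarith [(Nat.cast_nonneg n : (0 : ℝ) ≤ n)]))
    have h2 : c n x - 1 ≤ c n x * Real.log (c n x) := by
      have := Real.one_sub_inv_le_log_of_pos (c_pos n x)
      have h3 := mul_le_mul_of_nonneg_left this (c_pos n x).le
      rwa [mul_sub, mul_one, mul_inv_cancel₀ (c_pos n x).ne'] at h3
    simp only [hF]
    linarith
  have FC : ∀ n : ℕ, ∫ x, F n x ∂ρ ≤ C := by
    intro n
    have h1 := H (fun x => Real.log (c n x)) (mlc n) _ (lb n)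
    rw [← integral_rnDeriv_smul hac] at h1
    simp only [Real.exp_log (c_pos n _), smul_eq_mul] at h1
    have hpos : 0 < ∫ x, c n x ∂ρ := by
      have := integral_exp_pos (μ := ρ) (f := fun x => Real.log (c n x))
        (by simpa only [Real.exp_log (c_pos n _)] using ic n)
      simpa only [Real.exp_log (c_pos n _)] using this
    have h2 := Real.log_le_sub_one_of_pos hpos
    have h3 : ∫ x, F n x ∂ρ = ∫ x, φ x * Real.log (c n x) ∂ρ - ∫ x, c n x ∂ρ + 1 := by
      have i1 : Integrable (fun x => φ x * Real.log (c n x) - c n x) ρ := (iφl n).sub (ic n)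
      simp only [hF]
      rw [integral_add i1 (integrable_const _), integral_sub (iφl n) (ic n)]
      simp
    rw [h3]
    linarith
  have lim : ∀ x, Filter.Tendsto (fun n => F n x) Filter.atTop
      (nhds (φ x * Real.log (φ x) - φ x + 1)) := by
    intro x
    have lc : Filter.Tendsto (fun n => c n x) Filter.atTop (nhds (φ x)) := by
      have h1 : Filter.Tendsto (fun n : ℕ => max (1 / ((n : ℝ) + 1)) (φ x)) Filter.atTop
          (nhds (max 0 (φ x))) :=
        tendsto_one_div_add_atTop_nhds_zero_nat.max tendsto_const_nhds
      rw [max_eq_right (φ0 x)] at h1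
      refine h1.congr' ?_
      filter_upwards [Filter.eventually_ge_atTop ⌈φ x⌉₊] with n hn
      have : φ x ≤ (n : ℝ) + 1 := by
        have := (Nat.le_ceil (φ x)).trans (Nat.cast_le.2 hn)
        linarith
      simp only [hc, min_eq_left this]
    refine Filter.Tendsto.add_const _ (Filter.Tendsto.sub ?_ lc)
    rcases (φ0 x).eq_or_lt with h | h
    · simp [← h]
    · exact ((Real.continuousAt_log h.ne').tendsto.comp lc).const_mul _
  calc ∫⁻ x, ENNReal.ofReal (φ x * Real.log (φ x) - φ x + 1) ∂ρ
      = ∫⁻ x, Filter.liminf (fun n => ENNReal.ofReal (F n x)) Filter.atTop ∂ρ := by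
        refine lintegral_congr fun x => ?_
        exact ((ENNReal.continuous_ofReal.tendsto _).comp (lim x)).liminf_eq.symm
    _ ≤ Filter.liminf (fun n => ∫⁻ x, ENNReal.ofReal (F n x) ∂ρ) Filter.atTop :=
        lintegral_liminf_le fun n => (mF n).ennreal_ofReal
    _ ≤ Filter.liminf (fun _ : ℕ => ENNReal.ofReal C) Filter.atTop := by
        refine Filter.liminf_le_liminf (.of_forall fun n => ?_)
        rw [← ofReal_integral_eq_lintegral_ofReal (iF n) (.of_forall (F0 n))]
        exact ENNReal.ofReal_le_ofReal (FC n)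
    _ = ENNReal.ofReal C := by simp

section
variable {d : ℕ} {η : ℝ} {f g : EuclideanSpace ℝ (Fin d) → ℝ}

lemma integrable_jointDens (hη : 0 < η) (hf : Continuous f) (hg : Continuous g)
    (hfi : Integrable (fun x => Real.exp (-f x))) (hgi : Integrable (fun x => Real.exp (-g x))) :
    Integrable (jointDens d η f g) := by
  have h1 : Integrable (fun p : EuclideanSpace ℝ (Fin d) × EuclideanSpace ℝ (Fin d) =>
      Real.exp (-f p.1) * Real.exp (-g p.2)) := hfi.mul_prod hgi
  refine h1.mono' (by unfold jointDens; fun_prop) (.of_forall fun p => ?_)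
  rw [jointDens, Real.norm_of_nonneg (Real.exp_pos _).le, ← Real.exp_add, Real.exp_le_exp]
  have : 0 ≤ ‖p.1 - p.2‖ ^ 2 / (2 * η) := by positivity
  linarith

lemma integral_jointDens_pos (hη : 0 < η) (hf : Continuous f) (hg : Continuous g)
    (hfi : Integrable (fun x => Real.exp (-f x))) (hgi : Integrable (fun x => Real.exp (-g x))) :
    0 < ∫ q, jointDens d η f g q :=
  integral_exp_pos (integrable_jointDens hη hf hg hfi hgi)

lemma isProbabilityMeasure_targetXY (hη : 0 < η) (hf : Continuous f) (hg : Continuous g)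
    (hfi : Integrable (fun x => Real.exp (-f x))) (hgi : Integrable (fun x => Real.exp (-g x))) :
    IsProbabilityMeasure (targetXY d η f g) := by
  have p := integral_jointDens_pos hη hf hg hfi hgi
  refine ⟨?_⟩
  rw [targetXY, withDensity_apply _ MeasurableSet.univ, setLIntegral_univ,
    ← ofReal_integral_eq_lintegral_ofReal ((integrable_jointDens hη hf hg hfi hgi).div_const _)
      (.of_forall fun q => div_nonneg (Real.exp_pos _).le p.le), integral_div, div_self p.ne',
    ENNReal.ofReal_one]

lemma map_swap_targetXY : (targetXY d η f g).map Prod.swap = targetXY d η g f := by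
  have hd : ∀ p, jointDens d η g f (Prod.swap p) = jointDens d η f g p := fun p => by
    rw [jointDens, jointDens, Prod.fst_swap, Prod.snd_swap, norm_sub_rev]
    ring_nf
  have hZ : ∫ q, jointDens d η g f q = ∫ q, jointDens d η f g q := by
    have := integral_prod_swap (μ := (volume : Measure (EuclideanSpace ℝ (Fin d))))
      (ν := (volume : Measure (EuclideanSpace ℝ (Fin d)))) (jointDens d η g f)
    simp only [hd] at this
    exact this.symm
  ext s hs
  rw [Measure.map_apply measurable_swap hs, targetXY, targetXY,
    withDensity_apply _ (measurable_swap hs), withDensity_apply _ hs, hZ]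
  have mp : MeasurePreserving (Prod.swap : EuclideanSpace ℝ (Fin d) × EuclideanSpace ℝ (Fin d) →
      EuclideanSpace ℝ (Fin d) × EuclideanSpace ℝ (Fin d)) volume volume :=
    Measure.measurePreserving_swap
  have := mp.setLIntegral_comp_preimage_emb MeasurableEquiv.prodComm.measurableEmbedding
    (fun p => ENNReal.ofReal (jointDens d η g f p / ∫ q, jointDens d η f g q)) s
  simp only [hd] at this
  exact this

/-- The density of the `X`-marginal of the target. -/
def targetXDens (d : ℕ) (η : ℝ) (f g : EuclideanSpace ℝ (Fin d) → ℝ)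
    (x : EuclideanSpace ℝ (Fin d)) : ℝ :=
  Real.exp (-f x) * gibbsPartition d η g x / ∫ q, jointDens d η f g q

lemma measurable_targetXDens (hf : Continuous f) (hg : Continuous g) :
    Measurable (targetXDens d η f g) :=
  ((Real.continuous_exp.comp hf.neg).measurable.mul (measurable_gibbsPartition hg)).div_const _

lemma targetXY_eq_withDensity_compProd (hη : 0 < η) (hf : Continuous f) (hg : Continuous g)
    (hfi : Integrable (fun x => Real.exp (-f x))) (hgi : Integrable (fun x => Real.exp (-g x))) :
    targetXY d η f g = Measure.compProd
      (volume.withDensity fun x => ENNReal.ofReal (targetXDens d η f g x))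
      (gibbsKernel d η g) := by
  have Mg := isMarkovKernel_gibbsKernel hη hg hgi
  have pZ := integral_jointDens_pos hη hf hg hfi hgi
  have hj : Measurable (jointDens d η f g) := by
    have : Continuous (jointDens d η f g) := by unfold jointDens; fun_prop
    exact this.measurable
  have mD : Measurable fun x => ENNReal.ofReal (targetXDens d η f g x) :=
    (measurable_targetXDens hf hg).ennreal_ofReal
  have mJ : Measurable fun p => ENNReal.ofReal (jointDens d η f g p /
      ∫ q, jointDens d η f g q) := (hj.div_const _).ennreal_ofReal
  have e : ∀ x y, ENNReal.ofReal (jointDens d η f g (x, y) / ∫ q, jointDens d η f g q) =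
      ENNReal.ofReal (targetXDens d η f g x) * ENNReal.ofReal (condYgivenX d η g x y) := by
    intro x y
    have pz := gibbsPartition_pos hη hg hgi x
    have hD0 : 0 ≤ targetXDens d η f g x := by unfold targetXDens; positivity
    rw [← ENNReal.ofReal_mul hD0]
    congr 1
    have hc : condYgivenX d η g x y =
        Real.exp (-g y - ‖x - y‖ ^ 2 / (2 * η)) / gibbsPartition d η g x := rfl
    have hjd : jointDens d η f g (x, y) =
        Real.exp (-f x) * Real.exp (-g y - ‖x - y‖ ^ 2 / (2 * η)) := by
      rw [jointDens, ← Real.exp_add]; ring_nf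
    rw [hc, hjd, targetXDens]
    field_simp
  ext s hs
  rw [Measure.compProd_apply hs, targetXY, withDensity_apply _ hs,
    lintegral_withDensity_eq_lintegral_mul _ mD
      (ProbabilityTheory.Kernel.measurable_kernel_prodMk_left hs), ← lintegral_indicator hs]
  refine (lintegral_prod (μ := volume) (ν := volume) _ (mJ.indicator hs).aemeasurable).trans ?_
  refine lintegral_congr fun x => ?_
  have hsx : MeasurableSet (Prod.mk x ⁻¹' s) := measurable_prodMk_left hs
  rw [Pi.mul_apply, gibbsKernel_apply hg, withDensity_apply _ hsx,
    ← lintegral_const_mul _ (measurable_condYgivenX hg).of_uncurry_left.ennreal_ofReal,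
    ← lintegral_indicator hsx]
  refine lintegral_congr fun y => ?_
  by_cases h : (x, y) ∈ s
  · rw [Set.indicator_of_mem h, Set.indicator_of_mem (by exact h), e]
  · rw [Set.indicator_of_notMem h, Set.indicator_of_notMem (by exact h)]

lemma targetX_eq_withDensity (hη : 0 < η) (hf : Continuous f) (hg : Continuous g)
    (hfi : Integrable (fun x => Real.exp (-f x))) (hgi : Integrable (fun x => Real.exp (-g x))) :
    targetX d η f g = volume.withDensity fun x => ENNReal.ofReal (targetXDens d η f g x) := by
  have Mg := isMarkovKernel_gibbsKernel hη hg hgi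
  rw [targetX, targetXY_eq_withDensity_compProd hη hf hg hfi hgi]
  exact Measure.fst_compProd _ _

lemma targetXY_eq_compProd (hη : 0 < η) (hf : Continuous f) (hg : Continuous g)
    (hfi : Integrable (fun x => Real.exp (-f x))) (hgi : Integrable (fun x => Real.exp (-g x))) :
    targetXY d η f g = Measure.compProd (targetX d η f g) (gibbsKernel d η g) := by
  rw [targetX_eq_withDensity hη hf hg hfi hgi]
  exact targetXY_eq_withDensity_compProd hη hf hg hfi hgi

lemma isProbabilityMeasure_targetX (hη : 0 < η) (hf : Continuous f) (hg : Continuous g)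
    (hfi : Integrable (fun x => Real.exp (-f x))) (hgi : Integrable (fun x => Real.exp (-g x))) :
    IsProbabilityMeasure (targetX d η f g) := by
  have := isProbabilityMeasure_targetXY hη hf hg hfi hgi
  exact Measure.isProbabilityMeasure_map measurable_fst.aemeasurable

lemma bind_gibbsKernel_targetX (hη : 0 < η) (hf : Continuous f) (hg : Continuous g)
    (hfi : Integrable (fun x => Real.exp (-f x))) (hgi : Integrable (fun x => Real.exp (-g x))) :
    (targetX d η f g).bind (gibbsKernel d η g) = targetX d η g f := by
  have Mg := isMarkovKernel_gibbsKernel hη hg hgi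
  have := isProbabilityMeasure_targetX hη hf hg hfi hgi
  rw [← Measure.snd_compProd, ← targetXY_eq_compProd hη hf hg hfi hgi, targetX,
    ← map_swap_targetXY (f := f) (g := g), Measure.map_map measurable_fst measurable_swap]
  rfl

lemma bind_sweepKernel_targetX (hη : 0 < η) (hf : Continuous f) (hg : Continuous g)
    (hfi : Integrable (fun x => Real.exp (-f x))) (hgi : Integrable (fun x => Real.exp (-g x))) :
    (targetX d η f g).bind (sweepKernel d η f g) = targetX d η f g := by
  rw [sweepKernel, ← Measure.comp_assoc, bind_gibbsKernel_targetX hη hf hg hfi hgi,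
    bind_gibbsKernel_targetX hη hg hf hgi hfi]

lemma bind_iterSweep_targetX (hη : 0 < η) (hf : Continuous f) (hg : Continuous g)
    (hfi : Integrable (fun x => Real.exp (-f x))) (hgi : Integrable (fun x => Real.exp (-g x)))
    (k : ℕ) : (targetX d η f g).bind (iterSweep d η f g k) = targetX d η f g := by
  induction k with
  | zero => simp [iterSweep]
  | succ k ih => rw [iterSweep, ← Measure.comp_assoc, bind_sweepKernel_targetX hη hf hg hfi hgi, ih]

lemma integrable_norm_sq_targetX (hη : 0 < η) (hf : ConvexOn ℝ Set.univ f) (hg : Continuous g)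
    (hfi : Integrable (fun x => Real.exp (-f x))) (hgi : Integrable (fun x => Real.exp (-g x))) :
    Integrable (fun x => ‖x‖ ^ 2) (targetX d η f g) := by
  have hfc : Continuous f := hf.locallyLipschitz.continuous
  have pZ := integral_jointDens_pos hη hfc hg hfi hgi
  have mD := measurable_targetXDens (η := η) hfc hg
  rw [targetX_eq_withDensity hη hfc hg hfi hgi, integrable_withDensity_iff_integrable_smul'
    mD.ennreal_ofReal (.of_forall fun _ => ENNReal.ofReal_lt_top)]
  set Z := ∫ q, jointDens d η f g q
  set I := ∫ y, Real.exp (-g y)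
  refine ((hf.integrable_norm_sq_mul_exp_neg hfi).const_mul (I / Z)).mono'
    (mD.ennreal_ofReal.ennreal_toReal.aestronglyMeasurable.smul (by fun_prop))
    (.of_forall fun x => ?_)
  have pz := gibbsPartition_pos hη hg hgi x
  have hz : gibbsPartition d η g x ≤ I := by
    refine integral_mono (integrable_gibbs hη hg hgi x) hgi fun y => ?_
    have : 0 ≤ ‖x - y‖ ^ 2 / (2 * η) := by positivity
    exact Real.exp_le_exp.2 (by linarith)
  have hD0 : 0 ≤ targetXDens d η f g x := by unfold targetXDens; positivity
  rw [ENNReal.toReal_ofReal hD0, smul_eq_mul, Real.norm_of_nonneg (by positivity), targetXDens]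
  calc Real.exp (-f x) * gibbsPartition d η g x / Z * ‖x‖ ^ 2
      ≤ Real.exp (-f x) * I / Z * ‖x‖ ^ 2 := by gcongr
    _ = I / Z * (‖x‖ ^ 2 * Real.exp (-f x)) := by ring

end

lemma integral_bind_of_abs_le {E F : Type*} [MeasurableSpace E] [MeasurableSpace F]
    {m : Measure E} [IsProbabilityMeasure m] {κ : ProbabilityTheory.Kernel E F}
    [ProbabilityTheory.IsMarkovKernel κ] {ψ : F → ℝ} (hψ : Measurable ψ) {B : ℝ}
    (hB : ∀ y, |ψ y| ≤ B) : ∫ y, ψ y ∂(m.bind κ) = ∫ x, ∫ y, ψ y ∂(κ x) ∂m := by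
  rw [← Measure.snd_compProd, Measure.snd,
    integral_map measurable_snd.aemeasurable hψ.aestronglyMeasurable, Measure.integral_compProd]
  exact Integrable.of_bound (hψ.comp measurable_snd).aestronglyMeasurable B
    (.of_forall fun p => hB p.2)

/-- A log-Harnack inequality bounds the dual form of the divergence by the transport cost. -/
lemma LogHarnack.integral_bind_le {E F : Type*} [NormedAddCommGroup E] [MeasurableSpace E]
    [MeasurableSpace F] {c : ℝ} {κ : ProbabilityTheory.Kernel E F}
    [ProbabilityTheory.IsMarkovKernel κ] (H : LogHarnack c κ) {γ : Measure (E × E)}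
    [IsProbabilityMeasure γ] (hγ : Integrable (fun w => ‖w.1 - w.2‖ ^ 2) γ)
    {ψ : F → ℝ} (hψ : Measurable ψ) {B : ℝ} (hB : ∀ y, |ψ y| ≤ B) :
    ∫ y, ψ y ∂((γ.map Prod.fst).bind κ) ≤
      Real.log (∫ y, Real.exp (ψ y) ∂((γ.map Prod.snd).bind κ)) +
        c * ∫ w, ‖w.1 - w.2‖ ^ 2 ∂γ := by
  have p1 : IsProbabilityMeasure (γ.map Prod.fst) :=
    Measure.isProbabilityMeasure_map measurable_fst.aemeasurable
  have p2 : IsProbabilityMeasure (γ.map Prod.snd) :=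
    Measure.isProbabilityMeasure_map measurable_snd.aemeasurable
  have hme : Measurable fun z => Real.exp (ψ z) := by fun_prop
  have hBe : ∀ z, |Real.exp (ψ z)| ≤ Real.exp B := fun z => by
    rw [abs_of_pos (Real.exp_pos _)]; exact Real.exp_le_exp.2 (le_of_abs_le (hB z))
  rw [integral_bind_of_abs_le hψ hB, integral_bind_of_abs_le hme hBe]
  set a := fun y => ∫ z, ψ z ∂(κ y)
  set b := fun y => Real.log (∫ z, Real.exp (ψ z) ∂(κ y)) with hb
  have ma : Measurable a := measurable_integral_kernel κ hψ
  have mb : Measurable b := (measurable_integral_kernel κ hme).log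
  have ba : ∀ y, |a y| ≤ B := fun y => abs_integral_le_of_abs_le hB
  have bb : ∀ y, |b y| ≤ B := fun y => abs_log_integral_exp_le hψ hB
  have eb : ∀ y, ∫ z, Real.exp (ψ z) ∂(κ y) = Real.exp (b y) := fun y => by
    rw [hb, Real.exp_log (integral_exp_pos (integrable_exp_of_abs_le hψ hB))]
  simp only [eb]
  have i1 : Integrable (fun w : E × E => a w.1) γ :=
    Integrable.of_bound (ma.comp measurable_fst).aestronglyMeasurable B (.of_forall fun _ => ba _)
  have i2 : Integrable (fun w : E × E => b w.2) γ :=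
    Integrable.of_bound (mb.comp measurable_snd).aestronglyMeasurable B (.of_forall fun _ => bb _)
  have h1 : ∫ x, a x ∂(γ.map Prod.fst) = ∫ w, a w.1 ∂γ :=
    integral_map measurable_fst.aemeasurable ma.aestronglyMeasurable
  have h2 : ∫ x, b x ∂(γ.map Prod.snd) = ∫ w, b w.2 ∂γ :=
    integral_map measurable_snd.aemeasurable mb.aestronglyMeasurable
  have h3 : ∫ w, a w.1 ∂γ ≤ ∫ w, (b w.2 + c * ‖w.1 - w.2‖ ^ 2) ∂γ :=
    integral_mono i1 (i2.add (hγ.const_mul c)) fun w => H ψ hψ B hB w.1 w.2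
  rw [integral_add i2 (hγ.const_mul c), integral_const_mul, ← h1, ← h2] at h3
  have h4 := integral_le_log_integral_exp (m := γ.map Prod.snd) (φ := b)
    (Integrable.of_bound mb.aestronglyMeasurable B (.of_forall bb))
    (integrable_exp_of_abs_le mb bb)
  linarith

/-- Extending measures by a common kernel preserves the dual form of divergence bounds. -/
lemma integral_compProd_le_of_forall {F G : Type*} [MeasurableSpace F] [MeasurableSpace G]
    {m m' : Measure F} [IsProbabilityMeasure m] [IsProbabilityMeasure m']
    {L : ProbabilityTheory.Kernel F G} [ProbabilityTheory.IsMarkovKernel L] {C : ℝ}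
    (H : ∀ ψ : F → ℝ, Measurable ψ → ∀ B : ℝ, (∀ x, |ψ x| ≤ B) →
      ∫ x, ψ x ∂m ≤ Real.log (∫ x, Real.exp (ψ x) ∂m') + C)
    {ψ : F × G → ℝ} (hψ : Measurable ψ) {B : ℝ} (hB : ∀ y, |ψ y| ≤ B) :
    ∫ p, ψ p ∂(Measure.compProd m L) ≤
      Real.log (∫ p, Real.exp (ψ p) ∂(Measure.compProd m' L)) + C := by
  have i1 : Integrable ψ (Measure.compProd m L) :=
    Integrable.of_bound hψ.aestronglyMeasurable B (.of_forall hB)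
  have i2 : Integrable (fun p => Real.exp (ψ p)) (Measure.compProd m' L) :=
    integrable_exp_of_abs_le hψ hB
  have mu : Measurable fun x => ∫ y, ψ (x, y) ∂(L x) :=
    (hψ.stronglyMeasurable.integral_kernel_prod_right' (κ := L)).measurable
  have bu : ∀ x, |∫ y, ψ (x, y) ∂(L x)| ≤ B := fun x => abs_integral_le_of_abs_le fun y => hB _
  have h1 := H _ mu B bu
  rw [Measure.integral_compProd i1]
  refine h1.trans ?_
  gcongr
  · exact integral_exp_pos (integrable_exp_of_abs_le mu bu)
  rw [Measure.integral_compProd i2]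
  have hBe : ∀ p, |Real.exp (ψ p)| ≤ Real.exp B := fun p => by
    rw [abs_of_pos (Real.exp_pos _)]; exact Real.exp_le_exp.2 (le_of_abs_le (hB p))
  have me : Measurable fun x => ∫ y, Real.exp (ψ (x, y)) ∂(L x) :=
    ((Real.measurable_exp.comp hψ).stronglyMeasurable.integral_kernel_prod_right'
      (κ := L)).measurable
  have i3 : Integrable (fun x => ∫ y, Real.exp (ψ (x, y)) ∂(L x)) m' :=
    Integrable.of_bound me.aestronglyMeasurable (Real.exp B)
      (.of_forall fun x => abs_integral_le_of_abs_le fun y => hBe _)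
  refine integral_mono (integrable_exp_of_abs_le mu bu) i3 fun x => ?_
  have mx : Measurable fun y => ψ (x, y) := hψ.comp measurable_prodMk_left
  have ie := integrable_exp_of_abs_le (m := L x) mx (fun y => hB _)
  have := integral_le_log_integral_exp
    (Integrable.of_bound mx.aestronglyMeasurable B (.of_forall fun y => hB _)) ie
  exact (Real.le_log_iff_exp_le (integral_exp_pos ie)).1 this

section
variable {d : ℕ} {η : ℝ} {f g h : EuclideanSpace ℝ (Fin d) → ℝ}

lemma bind_gibbsKernel_eq_withDensity (hη : 0 < η) (hc : Continuous h)
    (hi : Integrable (fun x => Real.exp (-h x))) (m : Measure (EuclideanSpace ℝ (Fin d)))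
    [IsProbabilityMeasure m] :
    m.bind (gibbsKernel d η h) = volume.withDensity fun y =>
      ENNReal.ofReal (∫ x, condYgivenX d η h x y ∂m) := by
  have mc : Measurable (Function.uncurry fun x y => ENNReal.ofReal (condYgivenX d η h x y)) :=
    (measurable_condYgivenX hc).ennreal_ofReal
  have tot : ∫⁻ y, ∫⁻ x, ENNReal.ofReal (condYgivenX d η h x y) ∂m = 1 := by
    rw [← lintegral_lintegral_swap mc.aemeasurable]
    simp [lintegral_condYgivenX hη hc hi]
  have mI : Measurable fun y => ∫⁻ x, ENNReal.ofReal (condYgivenX d η h x y) ∂m :=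
    mc.lintegral_prod_left'
  have fin := ae_lt_top mI (by rw [tot]; exact ENNReal.one_ne_top)
  have e : ∀ᵐ y, ∫⁻ x, ENNReal.ofReal (condYgivenX d η h x y) ∂m =
      ENNReal.ofReal (∫ x, condYgivenX d η h x y ∂m) := by
    filter_upwards [fin] with y hy
    have my : Measurable fun x => condYgivenX d η h x y :=
      (measurable_condYgivenX hc).of_uncurry_right
    have iy : Integrable (fun x => condYgivenX d η h x y) m :=
      (lintegral_ofReal_ne_top_iff_integrable my.aestronglyMeasurable
        (.of_forall fun x => condYgivenX_nonneg hη hc hi x y)).1 hy.ne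
    rw [ofReal_integral_eq_lintegral_ofReal iy
      (.of_forall fun x => condYgivenX_nonneg hη hc hi x y)]
  rw [← withDensity_congr_ae e]
  ext s hs
  rw [Measure.bind_apply hs (gibbsKernel d η h).aemeasurable, withDensity_apply _ hs]
  simp only [gibbsKernel_apply hc, withDensity_apply _ hs]
  exact lintegral_lintegral_swap mc.aemeasurable

lemma condXgivenY_eq_condYgivenX (x y : EuclideanSpace ℝ (Fin d)) :
    condXgivenY d η f y x = condYgivenX d η f y x := by
  simp only [condXgivenY, condYgivenX, norm_sub_rev y]

lemma eq_bind_iterSweep (hη : 0 < η) (hf : Continuous f) (hg : Continuous g)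
    (hfi : Integrable (fun x => Real.exp (-f x))) (hgi : Integrable (fun x => Real.exp (-g x)))
    {μX μY : ℕ → Measure (EuclideanSpace ℝ (Fin d))} [IsProbabilityMeasure (μX 0)]
    (hμY : ∀ k, μY k = volume.withDensity fun y =>
      ENNReal.ofReal (∫ x, condYgivenX d η g x y ∂(μX k)))
    (hμX : ∀ k, μX (k + 1) = volume.withDensity fun x =>
      ENNReal.ofReal (∫ y, condXgivenY d η f y x ∂(μY k))) (k : ℕ) :
    μX k = (μX 0).bind (iterSweep d η f g k) := by
  have Mf := isMarkovKernel_gibbsKernel hη hf hfi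
  have Mg := isMarkovKernel_gibbsKernel hη hg hgi
  have MS := isMarkovKernel_iterSweep hη hf hg hfi hgi
  induction k with
  | zero => simp [iterSweep]
  | succ k ih =>
    have pX : IsProbabilityMeasure (μX k) := by rw [ih]; infer_instance
    have hY : μY k = (μX k).bind (gibbsKernel d η g) := by
      rw [hμY, bind_gibbsKernel_eq_withDensity hη hg hgi]
    have pY : IsProbabilityMeasure (μY k) := by rw [hY]; infer_instance
    have hX : μX (k + 1) = (μY k).bind (gibbsKernel d η f) := by
      rw [hμX, bind_gibbsKernel_eq_withDensity hη hf hfi]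
      simp only [condXgivenY_eq_condYgivenX]
    rw [hX, hY, iterSweep_succ', ← Measure.comp_assoc, ← ih, sweepKernel, Measure.comp_assoc]

end

/-- convergence of the two-node Gibbs sampler under convexity:
for convex `f`, `g`, `D_KL(μ_k^{XY} ‖ π^{XY}) ≤ W₂²(μ_0^X, π^X)/(kη)` for `k ≥ 1`. -/
theorem two_node_gibbs_convergence_convex
    (hd : 1 ≤ d) (hη : 0 < η)
    (f g : EuclideanSpace ℝ (Fin d) → ℝ)
    (hf : ConvexOn ℝ Set.univ f) (hg : ConvexOn ℝ Set.univ g)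
    (hfint : Integrable (fun x => Real.exp (-f x)))
    (hgint : Integrable (fun y => Real.exp (-g y)))
    (μX μY : ℕ → Measure (EuclideanSpace ℝ (Fin d)))
    [IsProbabilityMeasure (μX 0)]
    (hmom : Integrable (fun x => ‖x‖ ^ 2) (μX 0))
    (hKLfin : klDiv (μX 0) (targetX d η f g) < ⊤)
    (hμY : ∀ k, μY k = volume.withDensity fun y =>
      ENNReal.ofReal (∫ x, condYgivenX d η g x y ∂(μX k)))
    (hμX : ∀ k, μX (k + 1) = volume.withDensity fun x =>
      ENNReal.ofReal (∫ y, condXgivenY d η f y x ∂(μY k)))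
    (μXY : ℕ → Measure (EuclideanSpace ℝ (Fin d) × EuclideanSpace ℝ (Fin d)))
    (hμXY : ∀ k, ∀ s t : Set (EuclideanSpace ℝ (Fin d)),
      MeasurableSet s → MeasurableSet t →
      μXY k (s ×ˢ t) =
        ∫⁻ x in s, (volume.withDensity fun y =>
          ENNReal.ofReal (condYgivenX d η g x y)) t ∂(μX k)) :
    ∀ k : ℕ, 1 ≤ k →
      klDiv (μXY k) (targetXY d η f g) ≤
        ENNReal.ofReal (W2sq (μX 0) (targetX d η f g) / (k * η)) := by
  intro k hk
  have hfc : Continuous f := hf.locallyLipschitz.continuous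
  have hgc : Continuous g := hg.locallyLipschitz.continuous
  have Mg := isMarkovKernel_gibbsKernel hη hgc hgint
  have MS := isMarkovKernel_iterSweep hη hfc hgc hfint hgint k
  have pT := isProbabilityMeasure_targetX hη hfc hgc hfint hgint
  have pTT := isProbabilityMeasure_targetXY hη hfc hgc hfint hgint
  have hXk := eq_bind_iterSweep hη hfc hgc hfint hgint hμY hμX k
  have pX : IsProbabilityMeasure (μX k) := by rw [hXk]; infer_instance
  have hXYk : μXY k = Measure.compProd (μX k) (gibbsKernel d η g) := by
    symm
    refine Measure.ext_prod fun {s t} hs ht => ?_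
    rw [hμXY k s t hs ht, Measure.compProd_apply_prod hs ht]
    simp only [gibbsKernel_apply hgc]
  have pXY : IsProbabilityMeasure (μXY k) := by rw [hXYk]; infer_instance
  have hLH : LogHarnack (1 / (k * η)) (iterSweep d η f g k) := by
    obtain ⟨n, rfl⟩ : ∃ n, k = n + 1 := ⟨k - 1, by omega⟩
    refine (logHarnack_iterSweep hη hf hg hfint hgint n).mono ?_
    push_cast
    refine one_div_le_one_div_of_le (by positivity) ?_
    nlinarith [mul_nonneg hη.le (Nat.cast_nonneg n : (0 : ℝ) ≤ n)]
  have hk0 : (0 : ℝ) < k * η := mul_pos (Nat.cast_pos.2 hk) hη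
  refine klDiv_le_of_forall_integral_le fun ψ hψ B hB => ?_
  rw [← sub_le_iff_le_add', le_div_iff₀ hk0, W2sq]
  refine le_csInf ⟨_, (μX 0).prod (targetX d η f g), by simp, by simp, rfl⟩ ?_
  rintro r ⟨γ, h1, h2, rfl⟩
  have pγ : IsProbabilityMeasure γ := by
    refine ⟨?_⟩
    have := measure_univ (μ := μX 0)
    rwa [← h1, Measure.map_apply measurable_fst MeasurableSet.univ, Set.preimage_univ] at this
  have hγ : Integrable (fun w => ‖w.1 - w.2‖ ^ 2) γ := by
    have i1 : Integrable (fun w : EuclideanSpace ℝ (Fin d) × EuclideanSpace ℝ (Fin d) =>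
        ‖w.1‖ ^ 2) γ := by
      rw [← h1] at hmom
      exact hmom.comp_measurable measurable_fst
    have i2 : Integrable (fun w : EuclideanSpace ℝ (Fin d) × EuclideanSpace ℝ (Fin d) =>
        ‖w.2‖ ^ 2) γ := by
      have := integrable_norm_sq_targetX hη hf hgc hfint hgint
      rw [← h2] at this
      exact this.comp_measurable measurable_snd
    refine ((i1.add i2).const_mul 2).mono' (by fun_prop) (.of_forall fun w => ?_)
    rw [Real.norm_of_nonneg (by positivity)]
    have := parallelogram_law_with_norm ℝ w.1 w.2
    simp only [Pi.add_apply]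
    nlinarith [sq_nonneg ‖w.1 + w.2‖]
  have key := integral_compProd_le_of_forall (m := μX k) (m' := targetX d η f g)
    (L := gibbsKernel d η g) (C := 1 / (k * η) * ∫ w, ‖w.1 - w.2‖ ^ 2 ∂γ)
    (fun φ hφ B' hB' => by
      have := hLH.integral_bind_le hγ hφ hB'
      rwa [h1, h2, bind_iterSweep_targetX hη hfc hgc hfint hgint, ← hXk] at this) hψ hB
  rw [← hXYk, ← targetXY_eq_compProd hη hfc hgc hfint hgint, ← sub_le_iff_le_add',
    one_div, inv_mul_eq_div, le_div_iff₀ hk0] at key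
  exact key

end
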